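/- Let PPc be the set of cyclically reduced potentially positive elements of F₂ (so R∞ ⊆ PPc). Then R∞ is not negligible in PPc: the density function n ↦ (𝔤_n(R∞) + 1) / (𝔤_n(PPc) + 1) does not converge to 0 as n → ∞. -/

import Mathlib

abbrev F2 := FreeGroup (Fin 2)

def Positive2 (w : F2) : Prop :=
  w ∈ Submonoid.closure (Set.range (FreeGroup.of : Fin 2 → F2))

def PotPos2 (w : F2) : Prop := ∃ φ : F2 ≃* F2, Positive2 (φ w)

def CyclicallyReduced2 (w : F2) : Prop :=
  ∀ x ∈ w.toWord.head?, ∀ y ∈ w.toWord.getLast?, x ≠ (y.1, !y.2)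

/-- `u` occurs as a cyclic subword of `w`. -/
def CyclicSubword2 (u : List (Fin 2 × Bool)) (w : F2) : Prop :=
  u.length ≤ w.toWord.length ∧ u <:+: (w.toWord ++ w.toWord)

def lA : Fin 2 × Bool := (0, true)
def lAi : Fin 2 × Bool := (0, false)
def lB : Fin 2 × Bool := (1, true)
def lBi : Fin 2 × Bool := (1, false)

/-- The set `R∞`. -/
def Rinf : Set F2 :=
  {w | CyclicallyReduced2 w ∧ ¬ CyclicSubword2 [lAi, lBi] w ∧ ¬ CyclicSubword2 [lBi, lAi] w ∧
    ∀ k : ℕ, ¬ CyclicSubword2 ([lBi] ++ List.replicate k lA ++ [lBi]) w}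

/-- The set of cyclically reduced potentially positive elements. -/
def PPc : Set F2 := {w | CyclicallyReduced2 w ∧ PotPos2 w}

noncomputable def growth2 (S : Set F2) (n : ℕ) : ℕ :=
  Nat.card {w : F2 // w ∈ S ∧ FreeGroup.norm w = n}


lemma red_sub {L M : List (Fin 2 × Bool)} (h : FreeGroup.IsReduced M) (hi : L <:+: M) :
    FreeGroup.IsReduced L := by
  obtain ⟨p, q, rfl⟩ := hi
  exact List.IsChain.right_of_append (List.IsChain.left_of_append h)

section
open FreeGroup

/-- A folded labelled graph: oriented edges `E`, with involution, source map and labels. -/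
structure FGraph (E V : Type) where
  inv : E → E
  inv_inv : ∀ e, inv (inv e) = e
  src : E → V
  lab : E → F2
  lab_inv : ∀ e, lab (inv e) = (lab e)⁻¹
  hd : E → Fin 2 × Bool
  hd_spec : ∀ e, (lab e).toWord.head? = some (hd e)
  fold : ∀ e f, src e = src f → hd e = hd f → e = f

namespace FGraph
variable {E V : Type} (G : FGraph E V)

def IsPath : V → V → List E → Prop
  | o, t, [] => o = t
  | o, t, e :: l => G.src e = o ∧ IsPath (G.src (G.inv e)) t l

def NB (l : List E) : Prop := l.IsChain (fun e f => f ≠ G.inv e)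

def val (l : List E) : F2 := (l.map G.lab).prod

lemma last_spec (e : E) :
    (G.lab e).toWord.getLast? = some ((G.hd (G.inv e)).1, !(G.hd (G.inv e)).2) := by
  have h := G.hd_spec (G.inv e)
  rw [G.lab_inv, toWord_inv, invRev] at h
  rw [List.head?_reverse, List.getLast?_map] at h
  rcases hx : (G.lab e).toWord.getLast? with _ | x
  · simp [hx] at h
  · simp [hx] at h
    rw [← h]; simp

lemma word_nb : ∀ (l : List E) (o t : V), G.IsPath o t l → G.NB l →
    (G.val l).toWord = (l.map (fun e => (G.lab e).toWord)).flatten ∧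
      (G.val l).toWord.head? = l.head?.map G.hd := by
  intro l
  induction l with
  | nil => intro o t _ _; simp [val]
  | cons e l ih =>
    intro o t hp hnb
    obtain ⟨h1, h2⟩ := ih _ _ hp.2 (by unfold NB at hnb ⊢; exact hnb.tail)
    have hv : G.val (e :: l) = G.lab e * G.val l := by simp [val]
    have hred : FreeGroup.IsReduced ((G.lab e).toWord ++ (G.val l).toWord) := by
      unfold FreeGroup.IsReduced
      rw [List.isChain_append]
      refine ⟨isReduced_toWord, isReduced_toWord, ?_⟩
      intro x hx y hy hxy
      rw [G.last_spec] at hx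
      rw [h2] at hy
      cases l with
      | nil => simp at hy
      | cons f l =>
        simp at hx hy
        by_contra hne
        have hsrc : G.src f = G.src (G.inv e) := hp.2.1
        have : f = G.inv e := by
          apply G.fold _ _ hsrc
          rw [hy]
          rw [← hx] at hxy hne
          ext1
          · exact hxy.symm
          · simp at hne; exact hne.symm
        unfold NB at hnb
        rw [List.isChain_cons_cons] at hnb
        exact hnb.1 this
    have hw : (G.val (e :: l)).toWord = (G.lab e).toWord ++ (G.val l).toWord := by
      rw [hv, toWord_mul, hred.reduce_eq]
    refine ⟨by rw [hw, h1]; simp, ?_⟩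
    rw [hw, List.head?_append, G.hd_spec]; simp

lemma lab_norm_pos (e : E) : 1 ≤ (G.lab e).norm := by
  have := G.hd_spec e
  unfold FreeGroup.norm
  rcases h : (G.lab e).toWord with _ | ⟨x, l⟩
  · simp [h] at this
  · simp

lemma exists_nb : ∀ (l : List E) (o t : V), G.IsPath o t l →
    ∃ l', G.IsPath o t l' ∧ G.NB l' ∧ G.val l' = G.val l := by
  intro l
  induction l with
  | nil => intro o t h; exact ⟨[], h, by simp [NB], rfl⟩
  | cons e l ih =>
    intro o t h
    obtain ⟨l', h1, h2, h3⟩ := ih _ _ h.2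
    have hv : G.val (e :: l) = G.lab e * G.val l' := by rw [h3]; simp [val]
    cases l' with
    | nil => exact ⟨[e], ⟨h.1, h1⟩, by simp [NB], by rw [hv]; simp [val]⟩
    | cons f l'' =>
      by_cases hf : f = G.inv e
      · refine ⟨l'', ?_, ?_, ?_⟩
        · have := h1.2
          rw [hf, G.inv_inv, h.1] at this
          exact this
        · unfold NB at h2 ⊢; exact h2.tail
        · rw [hv]; simp [val, hf, G.lab_inv]
      · refine ⟨e :: f :: l'', ⟨h.1, h1⟩, ?_, by rw [hv]; simp [val]⟩
        unfold NB at h2 ⊢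
        rw [List.isChain_cons_cons]; exact ⟨hf, h2⟩

lemma isPath_append : ∀ (l₁ l₂ : List E) (o s t : V), G.IsPath o s l₁ → G.IsPath s t l₂ →
    G.IsPath o t (l₁ ++ l₂) := by
  intro l₁
  induction l₁ with
  | nil => intro l₂ o s t h1 h2; cases h1; exact h2
  | cons e l ih => intro l₂ o s t h1 h2; exact ⟨h1.1, ih _ _ _ _ h1.2 h2⟩

lemma val_append (l₁ l₂ : List E) : G.val (l₁ ++ l₂) = G.val l₁ * G.val l₂ := by simp [val]

lemma exists_inv : ∀ (l : List E) (o t : V), G.IsPath o t l →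
    ∃ l', G.IsPath t o l' ∧ G.val l' = (G.val l)⁻¹ := by
  intro l
  induction l with
  | nil => intro o t h; exact ⟨[], h.symm, by simp [val]⟩
  | cons e l ih =>
    intro o t h
    obtain ⟨l', h1, h2⟩ := ih _ _ h.2
    refine ⟨l' ++ [G.inv e], G.isPath_append _ _ _ _ _ h1 ⟨rfl, ?_⟩, ?_⟩
    · rw [G.inv_inv]; exact h.1
    · rw [val_append, h2]; simp [val, G.lab_inv]

/-- an element of norm one in the group of loops is the label of a single loop edge -/
lemma norm_one_edge (S : Set F2) (o : V) (hS : ∀ s ∈ S, ∃ l, G.IsPath o o l ∧ G.val l = s)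
    (g : F2) (hg : g ∈ Subgroup.closure S) (h1 : g.norm = 1) :
    ∃ e, G.src e = o ∧ G.src (G.inv e) = o ∧ G.lab e = g := by
  have key : ∃ l, G.IsPath o o l ∧ G.val l = g := by
    induction hg using Subgroup.closure_induction with
    | mem x hx => exact hS x hx
    | one => exact ⟨[], rfl, by simp [val]⟩
    | mul x y hx hy ihx ihy =>
      clear h1
      have aux : ∀ z ∈ Subgroup.closure S, ∃ l, G.IsPath o o l ∧ G.val l = z := by
        intro z hz
        induction hz using Subgroup.closure_induction with
        | mem x hx => exact hS x hx
        | one => exact ⟨[], rfl, by simp [val]⟩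
        | mul x y hx hy ihx ihy =>
          obtain ⟨l, h, h'⟩ := ihx; obtain ⟨m, k, k'⟩ := ihy
          exact ⟨l ++ m, G.isPath_append _ _ _ _ _ h k, by rw [val_append, h', k']⟩
        | inv x hx ih =>
          obtain ⟨l, h, h'⟩ := ih
          obtain ⟨m, k, k'⟩ := G.exists_inv _ _ _ h
          exact ⟨m, k, by rw [k', h']⟩
      exact aux _ (mul_mem hx hy)
    | inv x hx ih =>
      obtain ⟨l, h, h'⟩ := ih (by simpa using h1)
      obtain ⟨m, k, k'⟩ := G.exists_inv _ _ _ h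
      exact ⟨m, k, by rw [k', h']⟩
  obtain ⟨l, hl, hv⟩ := key
  obtain ⟨l', h1', h2', h3'⟩ := G.exists_nb _ _ _ hl
  rw [hv] at h3'
  have hw := (G.word_nb _ _ _ h1' h2').1
  rw [h3'] at hw
  have hlen : g.toWord.length = 1 := h1
  rw [hw] at hlen
  match l', h1', h3', hlen with
  | [], _, _, hlen => simp at hlen
  | [e], hp, hval, _ => exact ⟨e, hp.1, hp.2, by rw [← hval]; simp [val]⟩
  | e :: f :: l, _, _, hlen =>
    have he := G.lab_norm_pos e
    have hf := G.lab_norm_pos f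
    unfold FreeGroup.norm at he hf
    simp at hlen
    omega

end FGraph

end

section
open FreeGroup

abbrev ga : F2 := FreeGroup.of 0
abbrev gb : F2 := FreeGroup.of 1

def hom2 (u v : F2) : F2 →* F2 := FreeGroup.lift ![u, v]

@[simp] lemma hom2_a (u v : F2) : hom2 u v (FreeGroup.of 0) = u := by simp [hom2]
@[simp] lemma hom2_b (u v : F2) : hom2 u v (FreeGroup.of 1) = v := by simp [hom2]

lemma hom_ext2 {f g : F2 →* F2} (h0 : f ga = g ga) (h1 : f gb = g gb) : f = g := by
  apply FreeGroup.ext_hom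
  intro i
  fin_cases i
  · exact h0
  · exact h1

lemma hom_ext2' {f g : F2 →* F2} (h0 : f ga = g ga) (h1 : f gb = g gb) (w : F2) : f w = g w := by
  rw [hom_ext2 h0 h1]

/-- sign changes and the swap -/
def sA : F2 →* F2 := hom2 ga⁻¹ gb
def sB : F2 →* F2 := hom2 ga gb⁻¹
def sW : F2 →* F2 := hom2 gb ga

/-- elementary automorphisms and inverses -/
def el : Bool → Bool → (F2 →* F2)
  | true, true => hom2 ga (ga * gb)
  | true, false => hom2 ga (ga⁻¹ * gb)
  | false, true => hom2 (gb * ga) gb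
  | false, false => hom2 (gb⁻¹ * ga) gb

inductive Sg : (F2 →* F2) → Prop
  | id : Sg (MonoidHom.id F2)
  | a {φ} : Sg φ → Sg (φ.comp sA)
  | b {φ} : Sg φ → Sg (φ.comp sB)
  | w {φ} : Sg φ → Sg (φ.comp sW)

lemma Sg.comp {φ ψ : F2 →* F2} (h : Sg φ) (k : Sg ψ) : Sg (φ.comp ψ) := by
  induction k with
  | id => simpa using h
  | a _ ih => rw [← MonoidHom.comp_assoc]; exact ih.a
  | b _ ih => rw [← MonoidHom.comp_assoc]; exact ih.b
  | w _ ih => rw [← MonoidHom.comp_assoc]; exact ih.w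

lemma Sg.sA : Sg sA := by simpa using Sg.id.a
lemma Sg.sB : Sg sB := by simpa using Sg.id.b
lemma Sg.sW : Sg sW := by simpa using Sg.id.w

def Ph : List Bool → (F2 →* F2)
  | [] => MonoidHom.id F2
  | x :: l => (Ph l).comp (el x true)

def inn (c : F2) : F2 →* F2 := (MulAut.conj c).toMonoidHom

lemma inn_apply (c w : F2) : inn c w = c * w * c⁻¹ := by simp [inn]

def X (φ : F2 →* F2) : Prop :=
  ∃ c D1 l D2, Sg D1 ∧ Sg D2 ∧ ∀ w, φ w = c * D1 (Ph l (D2 w)) * c⁻¹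

lemma gen_comm (s : F2 →* F2) (hs : s = sA ∨ s = sB ∨ s = sW) (x y : Bool) :
    ∃ c x' y', s.comp (el x y) = (inn c).comp ((el x' y').comp s) := by
  rcases hs with rfl | rfl | rfl
  · cases x
    · cases y
      · exact ⟨gb⁻¹, false, true, hom_ext2 (by simp [sA, el, inn_apply, mul_assoc]) (by simp [sA, el, inn_apply])⟩
      · exact ⟨gb, false, false, hom_ext2 (by simp [sA, el, inn_apply, mul_assoc]) (by simp [sA, el, inn_apply])⟩
    · exact ⟨1, true, !y, hom_ext2 (by cases y <;> simp [sA, el, inn_apply, mul_assoc])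
        (by cases y <;> simp [sA, el, inn_apply])⟩
  · cases x
    · exact ⟨1, false, !y, hom_ext2 (by cases y <;> simp [sB, el, inn_apply, mul_assoc])
        (by cases y <;> simp [sB, el, inn_apply])⟩
    · cases y
      · exact ⟨ga⁻¹, true, true, hom_ext2 (by simp [sB, el, inn_apply, mul_assoc]) (by simp [sB, el, inn_apply, mul_assoc])⟩
      · exact ⟨ga, true, false, hom_ext2 (by simp [sB, el, inn_apply, mul_assoc]) (by simp [sB, el, inn_apply, mul_assoc])⟩
  · exact ⟨1, !x, y, hom_ext2 (by cases x <;> cases y <;> simp [sW, el, inn_apply])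
        (by cases x <;> cases y <;> simp [sW, el, inn_apply])⟩

lemma Sg_comm {D : F2 →* F2} (h : Sg D) : ∀ x y : Bool,
    ∃ c x' y', ∀ w, D (el x y w) = c * el x' y' (D w) * c⁻¹ := by
  have step : ∀ (φ s : F2 →* F2), (s = sA ∨ s = sB ∨ s = sW) →
      (∀ x y : Bool, ∃ c x' y', ∀ w, φ (el x y w) = c * el x' y' (φ w) * c⁻¹) →
      (∀ x y : Bool, ∃ c x' y', ∀ w, (φ.comp s) (el x y w) = c * el x' y' ((φ.comp s) w) * c⁻¹) := by
    intro φ s hs ih x y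
    obtain ⟨c, x', y', h1⟩ := gen_comm s hs x y
    obtain ⟨d, x2, y2, h2⟩ := ih x' y'
    refine ⟨φ c * d, x2, y2, fun w => ?_⟩
    have := DFunLike.congr_fun h1 w
    simp only [MonoidHom.comp_apply, inn_apply] at this
    simp only [MonoidHom.comp_apply]
    rw [this]
    simp [h2, mul_assoc]
  induction h with
  | id => intro x y; exact ⟨1, x, y, by simp⟩
  | a _ ih => exact step _ _ (by simp) ih
  | b _ ih => exact step _ _ (by simp) ih
  | w _ ih => exact step _ _ (by simp) ih

lemma el_cancel (x : Bool) (w : F2) : el x true (el x false w) = w := by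
  have : (el x true).comp (el x false) = MonoidHom.id F2 :=
    hom_ext2 (by cases x <;> simp [el]) (by cases x <;> simp [el])
  exact DFunLike.congr_fun this w

lemma Ph_el (l : List Bool) (x y : Bool) :
    ∃ c D1 l' D2, Sg D1 ∧ Sg D2 ∧ ∀ w, Ph l (el x y w) = c * D1 (Ph l' (D2 w)) * c⁻¹ := by
  cases y with
  | true => exact ⟨1, _, x :: l, _, Sg.id, Sg.id, fun w => by simp [Ph]⟩
  | false =>
    cases l with
    | nil =>
      cases x with
      | true =>
        refine ⟨1, _, [true], _, Sg.sA, Sg.sA, fun w => ?_⟩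
        have : el true false = sA.comp ((el true true).comp sA) :=
          hom_ext2 (by simp [el, sA]) (by simp [el, sA])
        simp [Ph, this]
      | false =>
        refine ⟨1, _, [false], _, Sg.sB, Sg.sB, fun w => ?_⟩
        have : el false false = sB.comp ((el false true).comp sB) :=
          hom_ext2 (by simp [el, sB]) (by simp [el, sB])
        simp [Ph, this]
    | cons z l =>
      by_cases hz : z = x
      · subst hz
        exact ⟨1, _, l, _, Sg.id, Sg.id, fun w => by simp [Ph, el_cancel]⟩
      · cases x with
        | true =>
          obtain rfl : z = false := by simpa using hz
          have : (el false true).comp (el true false)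
              = (inn ga⁻¹).comp ((el true true).comp (sW.comp sB)) :=
            hom_ext2 (by simp [el, sW, sB, inn_apply, mul_assoc]) (by simp [el, sW, sB, inn_apply, mul_assoc])
          refine ⟨Ph l ga⁻¹, _, true :: l, _, Sg.id, Sg.sW.comp Sg.sB, fun w => ?_⟩
          have := DFunLike.congr_fun this w
          simp only [MonoidHom.comp_apply, inn_apply] at this
          simp [Ph, this]
        | false =>
          obtain rfl : z = true := by simpa using hz
          have : (el true true).comp (el false false)
              = (inn gb⁻¹).comp ((el false true).comp (sW.comp sA)) :=
            hom_ext2 (by simp [el, sW, sA, inn_apply, mul_assoc]) (by simp [el, sW, sA, inn_apply, mul_assoc])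
          refine ⟨Ph l gb⁻¹, _, false :: l, _, Sg.id, Sg.sW.comp Sg.sA, fun w => ?_⟩
          have := DFunLike.congr_fun this w
          simp only [MonoidHom.comp_apply, inn_apply] at this
          simp [Ph, this]

lemma X.comp_el {φ : F2 →* F2} (h : X φ) (x y : Bool) : X (φ.comp (el x y)) := by
  obtain ⟨c, D1, l, D2, h1, h2, h3⟩ := h
  obtain ⟨d, x', y', h4⟩ := Sg_comm h2 x y
  obtain ⟨f, D1', l', D2', h5, h6, h7⟩ := Ph_el l x' y'
  refine ⟨c * D1 (Ph l d) * D1 f, D1.comp D1', l', D2'.comp D2, h1.comp h5, h6.comp h2, fun w => ?_⟩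
  simp [h3, h4, h7, mul_assoc]

lemma X.comp_Sg {φ ψ : F2 →* F2} (h : X φ) (k : Sg ψ) : X (φ.comp ψ) := by
  obtain ⟨c, D1, l, D2, h1, h2, h3⟩ := h
  exact ⟨c, D1, l, D2.comp ψ, h1, h2.comp k, fun w => by simp [h3]⟩

def XX (u v : F2) : Prop := X (hom2 u v)

lemma XX.inv {u v : F2} (h : XX u v) : XX u⁻¹ v := by
  have := X.comp_Sg h Sg.sA
  have e : (hom2 u v).comp sA = hom2 u⁻¹ v := hom_ext2 (by simp [sA]) (by simp [sA])
  rwa [e] at this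

lemma XX.swap {u v : F2} (h : XX u v) : XX v u := by
  have := X.comp_Sg h Sg.sW
  have e : (hom2 u v).comp sW = hom2 v u := hom_ext2 (by simp [sW]) (by simp [sW])
  rwa [e] at this

lemma XX.mulL {u v : F2} (h : XX u v) : XX u (u⁻¹ * v) := by
  have := X.comp_el h true false
  have e : (hom2 u v).comp (el true false) = hom2 u (u⁻¹ * v) := hom_ext2 (by simp [el]) (by simp [el])
  rwa [e] at this

lemma XX.conj {u v : F2} (h : XX u v) (g : F2) : XX (g * u * g⁻¹) (g * v * g⁻¹) := by
  obtain ⟨c, D1, l, D2, h1, h2, h3⟩ := h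
  refine ⟨g * c, D1, l, D2, h1, h2, fun w => ?_⟩
  have : hom2 (g * u * g⁻¹) (g * v * g⁻¹) = (inn g).comp (hom2 u v) :=
    hom_ext2 (by simp [inn_apply]) (by simp [inn_apply])
  rw [this]
  simp [inn_apply, h3, mul_assoc]

lemma XX.base : XX ga gb := by
  refine ⟨1, _, [], _, Sg.id, Sg.id, fun w => ?_⟩
  have : hom2 ga gb = MonoidHom.id F2 := hom_ext2 (by simp) (by simp)
  simp [this, Ph]

end

section
open FreeGroup

def GW (u v : F2) : Prop := Function.Surjective (hom2 u v) → XX u v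

lemma sA_surj : Function.Surjective sA := fun w => ⟨sA w, by
  have : sA.comp sA = MonoidHom.id F2 := hom_ext2 (by simp [sA]) (by simp [sA])
  exact DFunLike.congr_fun this w⟩
lemma sW_surj : Function.Surjective sW := fun w => ⟨sW w, by
  have : sW.comp sW = MonoidHom.id F2 := hom_ext2 (by simp [sW]) (by simp [sW])
  exact DFunLike.congr_fun this w⟩
lemma inn_surj (c : F2) : Function.Surjective (inn c) := (MulAut.conj c).surjective

lemma GW.inv {u v : F2} (h : GW u⁻¹ v) : GW u v := by
  intro hs
  have e : (hom2 u v).comp sA = hom2 u⁻¹ v := hom_ext2 (by simp [sA]) (by simp [sA])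
  have := h (by rw [← e]; exact hs.comp sA_surj)
  simpa using this.inv

lemma GW.swap {u v : F2} (h : GW v u) : GW u v := by
  intro hs
  have e : (hom2 u v).comp sW = hom2 v u := hom_ext2 (by simp [sW]) (by simp [sW])
  exact (h (by rw [← e]; exact hs.comp sW_surj)).swap

lemma GW.mulL {u v : F2} (h : GW u (u⁻¹ * v)) : GW u v := by
  intro hs
  have e : (hom2 u v).comp (el true false) = hom2 u (u⁻¹ * v) :=
    hom_ext2 (by simp [el]) (by simp [el])
  have e2 : Function.Surjective (el true false) := fun w => ⟨el true true w, by
    have : (el true false).comp (el true true) = MonoidHom.id F2 :=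
      hom_ext2 (by simp [el]) (by simp [el])
    exact DFunLike.congr_fun this w⟩
  have := (h (by rw [← e]; exact hs.comp e2)).inv.mulL.inv
  simpa using this

lemma hom2_conj (g u v : F2) : hom2 (g * u * g⁻¹) (g * v * g⁻¹) = (inn g).comp (hom2 u v) :=
  hom_ext2 (by simp [inn_apply]) (by simp [inn_apply])

lemma GW.conj {u v : F2} (g : F2) (h : GW (g * u * g⁻¹) (g * v * g⁻¹)) : GW u v := by
  intro hs
  have := (h (by rw [hom2_conj]; exact (inn_surj g).comp hs)).conj g⁻¹
  simpa [mul_assoc] using this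

def Th (x y z : F2) : Prop := GW (x⁻¹ * y) (x⁻¹ * z)

lemma Th.swap {x y z : F2} (h : Th x z y) : Th x y z := GW.swap h
lemma Th.rot {x y z : F2} (h : Th y x z) : Th x y z := by
  unfold Th at *
  apply GW.mulL
  apply GW.inv
  have : (x⁻¹ * y)⁻¹ * (x⁻¹ * z) = y⁻¹ * z := by group
  rw [this]; simpa using h
lemma Th.left {x y z : F2} (g : F2) (h : Th (g * x) (g * y) (g * z)) : Th x y z := by
  unfold Th at *
  simpa [mul_assoc] using h
lemma Th.right {x y z : F2} (g : F2) (h : Th (x * g) (y * g) (z * g)) : Th x y z := by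
  unfold Th at *
  apply GW.conj g⁻¹
  simpa [mul_assoc] using h

def hdw (g : F2) : Option (Fin 2 × Bool) := g.toWord.head?

lemma hdw_ne_none {g : F2} (h : g ≠ 1) : ∃ c, hdw g = some c := by
  unfold hdw
  rcases hg : g.toWord with _ | ⟨c, l⟩
  · exact absurd (toWord_eq_nil_iff.1 hg) h
  · exact ⟨c, by simp⟩

lemma norm_strip {g : F2} {c : Fin 2 × Bool} (h : hdw g = some c) :
    ((FreeGroup.mk [c])⁻¹ * g).norm + 1 ≤ g.norm := by
  unfold hdw at h
  rcases hg : g.toWord with _ | ⟨d, l⟩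
  · simp [hg] at h
  · have hd : d = c := by simpa [hg] using h
    subst hd
    have e : g = FreeGroup.mk [d] * FreeGroup.mk l := by
      rw [← FreeGroup.mk_toWord (x := g), hg]; simp
    have : g.norm = l.length + 1 := by unfold FreeGroup.norm; rw [hg]; simp
    rw [this, e]
    simp only [inv_mul_cancel_left]
    have := FreeGroup.norm_mk_le (L₁ := l)
    omega

lemma norm_strip_le (g : F2) (c : Fin 2 × Bool) :
    ((FreeGroup.mk [c])⁻¹ * g).norm ≤ g.norm + 1 := by
  have h := FreeGroup.norm_mul_le (FreeGroup.mk [c])⁻¹ g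
  have h2 := FreeGroup.norm_mk_le (L₁ := [c])
  rw [FreeGroup.norm_inv_eq] at h
  simp at h2
  omega

lemma T1 {n : ℕ} (ih : ∀ x y z : F2, x.norm + y.norm + z.norm < n → Th x y z)
    {x y z : F2} (hn : x.norm + y.norm + z.norm ≤ n) {c} (hx : hdw x = some c)
    (hy : hdw y = some c) : Th x y z := by
  apply Th.left (FreeGroup.mk [c])⁻¹
  apply ih
  have h1 := norm_strip hx
  have h2 := norm_strip hy
  have h3 := norm_strip_le z c
  omega

lemma T2 {n : ℕ} (ih : ∀ x y z : F2, x.norm + y.norm + z.norm < n → Th x y z)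
    {x y z : F2} (hn : x.norm + y.norm + z.norm ≤ n) {c} (hx : hdw x⁻¹ = some c)
    (hy : hdw y⁻¹ = some c) : Th x y z := by
  apply Th.right (FreeGroup.mk [c])
  apply ih
  have h1 := norm_strip hx
  have h2 := norm_strip hy
  have h3 := norm_strip_le z⁻¹ c
  rw [← FreeGroup.norm_inv_eq] at h1 h2 h3
  simp only [mul_inv_rev, inv_inv, FreeGroup.norm_inv_eq] at h1 h2 h3
  omega

lemma word_nocancel {u v : F2} (h : ∀ c, hdw u = some c → hdw v ≠ some c) :
    (u⁻¹ * v).toWord = u⁻¹.toWord ++ v.toWord := by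
  rw [toWord_mul]
  apply FreeGroup.IsReduced.reduce_eq
  unfold FreeGroup.IsReduced
  rw [List.isChain_append]
  refine ⟨isReduced_toWord, isReduced_toWord, ?_⟩
  intro x hx y hy hxy
  by_contra hne
  refine h y ?_ hy
  rw [toWord_inv, invRev, Option.mem_def, List.getLast?_reverse, List.head?_map] at hx
  unfold hdw
  rcases hd : u.toWord.head? with _ | d
  · simp [hd] at hx
  · simp [hd] at hx
    congr 1
    rw [← hx] at hxy hne
    ext1
    · exact hxy
    · simp at hne
      exact hne

lemma cyc_decomp (y : F2) (hy : y ≠ 1) : ∃ p y' : F2, y = p * y' * p⁻¹ ∧ y' ≠ 1 ∧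
    hdw y' ≠ hdw y'⁻¹ ∧ (p ≠ 1 → hdw p⁻¹ ≠ hdw y' ∧ hdw p⁻¹ ≠ hdw y'⁻¹ ∧
      hdw y = hdw p ∧ hdw y⁻¹ = hdw p) := by
  set P := reduceCyclically.conjugator y.toWord
  set Y := reduceCyclically y.toWord
  have hdec : P ++ Y ++ invRev P = y.toWord :=
    reduceCyclically.conj_conjugator_reduceCyclically y.toWord
  have hred : FreeGroup.IsReduced (P ++ Y ++ invRev P) := by rw [hdec]; exact isReduced_toWord
  have hcyc : IsCyclicallyReduced Y := reduceCyclically.isCyclicallyReduced isReduced_toWord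
  have hP : (FreeGroup.mk P).toWord = P := by
    rw [toWord_mk]; exact (red_sub hred ⟨[], Y ++ invRev P, by simp⟩).reduce_eq
  have hY : (FreeGroup.mk Y).toWord = Y := by
    rw [toWord_mk]; exact hcyc.1.reduce_eq
  have hyeq : y = FreeGroup.mk P * FreeGroup.mk Y * (FreeGroup.mk P)⁻¹ := by
    rw [inv_mk, mul_mk, mul_mk, hdec, mk_toWord]
  have hYne : Y ≠ [] := by
    intro h0
    apply hy
    have h1 : FreeGroup.mk ([] : List (Fin 2 × Bool)) = 1 := rfl
    rw [hyeq, h0, h1]; group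
  have hinv : ∀ L : List (Fin 2 × Bool), (invRev L).head? = L.getLast?.map (fun c => (c.1, !c.2)) := by
    intro L; simp [invRev]
  refine ⟨FreeGroup.mk P, FreeGroup.mk Y, hyeq, ?_, ?_, ?_⟩
  · intro h; apply hYne; rw [← hY, h]; simp
  · unfold hdw
    rw [toWord_inv, hY, hinv]
    intro h
    rcases h1 : Y.head? with _ | c
    · simp at h1; exact hYne h1
    rcases h2 : Y.getLast? with _ | d
    · simp at h2; exact hYne h2
    have := hcyc.2 d h2 c h1
    rw [h1, h2] at h
    simp at h
    rw [h] at this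
    simp at this
  · intro hp
    have hPne : P ≠ [] := by intro h; apply hp; rw [h]; rfl
    obtain ⟨d, hd⟩ : ∃ d, P.getLast? = some d := by
      rcases h : P.getLast? with _ | d
      · simp at h; exact absurd h hPne
      · exact ⟨d, rfl⟩
    obtain ⟨f, hf⟩ : ∃ d, P.head? = some d := by
      rcases h : P.head? with _ | d
      · simp at h; exact absurd h hPne
      · exact ⟨d, rfl⟩
    obtain ⟨c, hc⟩ : ∃ d, Y.head? = some d := by
      rcases h : Y.head? with _ | d
      · simp at h; exact absurd h hYne
      · exact ⟨d, rfl⟩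
    obtain ⟨e, he⟩ : ∃ d, Y.getLast? = some d := by
      rcases h : Y.getLast? with _ | d
      · simp at h; exact absurd h hYne
      · exact ⟨d, rfl⟩
    have c1 : FreeGroup.IsReduced (P ++ Y) := red_sub hred ⟨[], invRev P, by simp⟩
    have c2 : FreeGroup.IsReduced (Y ++ invRev P) := red_sub hred ⟨P, [], by simp⟩
    unfold FreeGroup.IsReduced at c1 c2
    rw [List.isChain_append] at c1 c2
    have d1 := c1.2.2 d hd c hc
    have d2 := c2.2.2 e he (d.1, !d.2) (by rw [hinv, hd]; simp)
    unfold hdw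
    rw [toWord_inv, toWord_inv, toWord_inv, hY, hP, hinv, hinv, hinv, ← hdec, hd, hc, he, hf]
    refine ⟨?_, ?_, ?_, ?_⟩
    · simp only [Option.map_some, ne_eq, Option.some.injEq]
      intro h
      rw [← h] at d1; simp at d1
    · simp only [Option.map_some, ne_eq, Option.some.injEq]
      intro h
      have : d = e := by
        have h1 := congrArg Prod.fst h; have h2 := congrArg Prod.snd h
        simp at h1 h2
        exact Prod.ext h1 h2
      rw [this] at d2; simp at d2
    · rw [List.append_assoc, List.head?_append, hf]; rfl
    · rw [List.getLast?_append]
      have : (invRev P).getLast? = P.head?.map (fun c => (c.1, !c.2)) := by simp [invRev]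
      rw [this, hf]; simp

end

section
open FreeGroup

def lbE {I : Type} (l : I → F2) : I × Bool → F2
  | (i, true) => l i
  | (i, false) => (l i)⁻¹

def srE {I V : Type} (s t : I → V) : I × Bool → V
  | (i, true) => s i
  | (i, false) => t i

lemma hdw_exists {I : Type} {l : I → F2} (hne : ∀ i, l i ≠ 1) (e : I × Bool) :
    ∃ c, hdw (lbE l e) = some c := by
  apply hdw_ne_none
  rcases e with ⟨i, x⟩
  cases x <;> simp [lbE, hne]

noncomputable def mkG {I V : Type} (s t : I → V) (l : I → F2) (hne : ∀ i, l i ≠ 1)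
    (hf : ∀ e f : I × Bool, srE s t e = srE s t f → hdw (lbE l e) = hdw (lbE l f) → e = f) :
    FGraph (I × Bool) V where
  inv e := (e.1, !e.2)
  inv_inv e := by simp
  src := srE s t
  lab := lbE l
  lab_inv := by rintro ⟨i, x⟩; cases x <;> simp [lbE]
  hd e := (hdw_exists hne e).choose
  hd_spec e := (hdw_exists hne e).choose_spec
  fold e f h1 h2 := hf e f h1 (by rw [(hdw_exists hne e).choose_spec, (hdw_exists hne f).choose_spec, h2])

lemma surj_closure {u v : F2} (h : Function.Surjective (hom2 u v)) (g : F2) :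
    g ∈ Subgroup.closure ({u, v} : Set F2) := by
  obtain ⟨w, rfl⟩ := h g
  have : (hom2 u v).range = Subgroup.closure (Set.range ![u, v]) := FreeGroup.range_lift_eq_closure
  have h2 : Set.range ![u, v] = {u, v} := by simp [Matrix.range_cons]; exact Set.pair_comm _ _
  rw [← h2, ← this]
  exact ⟨w, rfl⟩

lemma ga_ne_gb : ga ≠ gb := by intro h; have := FreeGroup.of_injective h; simp at this
lemma ga_ne_gb' : ga ≠ gb⁻¹ := by
  intro h
  have := congrArg FreeGroup.toWord h
  simp [FreeGroup.toWord_inv, invRev] at this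

lemma theta_case {x y z : F2} (hx : x ≠ 1) (hy : y ≠ 1) (hz : z ≠ 1)
    (h1 : hdw x ≠ hdw y) (h2 : hdw x ≠ hdw z) (h3 : hdw y ≠ hdw z)
    (k1 : hdw x⁻¹ ≠ hdw y⁻¹) (k2 : hdw x⁻¹ ≠ hdw z⁻¹) (k3 : hdw y⁻¹ ≠ hdw z⁻¹) : Th x y z := by
  intro hs
  exfalso
  let G : FGraph (Fin 3 × Bool) Bool := mkG (fun _ => false) (fun _ => true) ![x, y, z]
    (by intro i; fin_cases i <;> simp [hx, hy, hz])
    (by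
      have := h1.symm; have := h2.symm; have := h3.symm; have := k1.symm
      have := k2.symm; have := k3.symm
      rintro ⟨i, a⟩ ⟨j, b⟩
      fin_cases i <;> fin_cases j <;> cases a <;> cases b <;> simp_all [srE, lbE])
  obtain ⟨e, h1, h2, -⟩ := G.norm_one_edge {x⁻¹ * y, x⁻¹ * z} true (by
    intro s hs
    rcases hs with rfl | rfl
    · exact ⟨[(0, false), (1, true)], by simp [FGraph.IsPath, G, mkG, srE], by simp [FGraph.val, G, mkG, lbE]⟩
    · exact ⟨[(0, false), (2, true)], by simp [FGraph.IsPath, G, mkG, srE], by simp [FGraph.val, G, mkG, lbE]⟩)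
    ga (surj_closure hs ga) (by simp)
  rcases e with ⟨i, b⟩
  cases b <;> simp [G, mkG, srE] at h1 h2

lemma XX_of_pm {y z : F2} (h1 : ga = y ∨ ga = y⁻¹ ∨ ga = z ∨ ga = z⁻¹)
    (h2 : gb = y ∨ gb = y⁻¹ ∨ gb = z ∨ gb = z⁻¹) : XX y z := by
  have n1 := ga_ne_gb
  have n2 := ga_ne_gb'
  have key : ∀ y z : F2, (ga = y ∨ ga = y⁻¹) → (gb = z ∨ gb = z⁻¹) → XX y z := by
    intro y z h1 h2
    have a1 : ∀ z, XX ga z → XX y z := by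
      intro z h
      rcases h1 with rfl | h
      · exact h
      · rw [← inv_inv y, ← h]; exact XX.inv ‹_›
    apply a1
    rcases h2 with rfl | h
    · exact XX.base
    · rw [← inv_inv z, ← h]; exact XX.base.swap.inv.swap
  have nn : ∀ y : F2, (ga = y ∨ ga = y⁻¹) → (gb = y ∨ gb = y⁻¹) → False := by
    rintro y (rfl | h1) (h2 | h2)
    · exact n1 h2.symm
    · exact n2 (by rw [h2]; simp)
    · exact n2 (by rw [h1, h2])
    · exact n1 (by rw [h1, h2])
  have h1' : (ga = y ∨ ga = y⁻¹) ∨ (ga = z ∨ ga = z⁻¹) := by tauto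
  have h2' : (gb = y ∨ gb = y⁻¹) ∨ (gb = z ∨ gb = z⁻¹) := by tauto
  rcases h1' with h1 | h1 <;> rcases h2' with h2 | h2
  · exact (nn _ h1 h2).elim
  · exact key _ _ h1 h2
  · exact (key _ _ h1 h2).swap
  · exact (nn _ h1 h2).elim

lemma rose_case {y z : F2} (hy : y ≠ 1) (hz : z ≠ 1) (h1 : hdw y ≠ hdw z) (h2 : hdw y ≠ hdw z⁻¹)
    (h3 : hdw y⁻¹ ≠ hdw z) (h4 : hdw y⁻¹ ≠ hdw z⁻¹) (h5 : hdw y ≠ hdw y⁻¹)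
    (h6 : hdw z ≠ hdw z⁻¹) : GW y z := by
  intro hs
  let G : FGraph (Fin 2 × Bool) Unit := mkG (fun _ => ()) (fun _ => ()) ![y, z]
    (by intro i; fin_cases i <;> simp [hy, hz])
    (by
      have := h1.symm; have := h2.symm; have := h3.symm; have := h4.symm
      have := h5.symm; have := h6.symm
      rintro ⟨i, a⟩ ⟨j, b⟩
      fin_cases i <;> fin_cases j <;> cases a <;> cases b <;> simp_all [srE, lbE])
  have key : ∀ g : F2, g.norm = 1 → g = y ∨ g = y⁻¹ ∨ g = z ∨ g = z⁻¹ := by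
    intro g hg
    obtain ⟨e, -, -, h⟩ := G.norm_one_edge {y, z} () (by
      intro s hs
      rcases hs with rfl | rfl
      · exact ⟨[(0, true)], by simp [FGraph.IsPath, G, mkG, srE], by simp [FGraph.val, G, mkG, lbE]⟩
      · exact ⟨[(1, true)], by simp [FGraph.IsPath, G, mkG, srE], by simp [FGraph.val, G, mkG, lbE]⟩)
      g (surj_closure hs g) hg
    rcases e with ⟨i, b⟩
    fin_cases i <;> cases b <;> simp [G, mkG, lbE] at h <;> simp [← h]
  exact XX_of_pm (key _ (by simp)) (key _ (by simp))

lemma one_case (z : F2) : GW 1 z := by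
  intro hs
  exfalso
  have h : ∀ g, g ∈ Subgroup.zpowers z := by
    intro g
    have := surj_closure hs g
    rw [Subgroup.closure_insert_one] at this
    rwa [Subgroup.zpowers_eq_closure]
  obtain ⟨i, hi⟩ := h ga
  obtain ⟨j, hj⟩ := h gb
  have hc : ga * gb = gb * ga := by
    rw [← hi, ← hj]; simp only [← zpow_add]; rw [add_comm]
  have := congrArg FreeGroup.toWord hc
  revert this
  decide

lemma barbell_case {y z : F2} (hy : y ≠ 1) (hz : z ≠ 1) (h1 : hdw y ≠ hdw z)
    (h2 : hdw y ≠ hdw z⁻¹) (h5 : hdw y = hdw y⁻¹) : GW y z := by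
  intro hs
  exfalso
  obtain ⟨p, y', hyp, hy1, hyh, hp⟩ := cyc_decomp y hy
  obtain ⟨q, z', hzq, hz1, hzh, hq⟩ := cyc_decomp z hz
  have hp1 : p ≠ 1 := by
    rintro rfl
    simp at hyp
    subst hyp
    exact hyh h5
  obtain ⟨p1, p2, p3, p4⟩ := hp hp1
  have hpq : ∀ c, hdw p = some c → hdw q ≠ some c := by
    intro c hc hc2
    by_cases hq1 : q = 1
    · subst hq1; simp [hdw] at hc2
    · obtain ⟨q1, q2, q3, q4⟩ := hq hq1
      exact h1 (by rw [p3, q3, hc, hc2])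
  set r := p⁻¹ * q with hr
  have hrw : r.toWord = p⁻¹.toWord ++ q.toWord := word_nocancel hpq
  have hri : r⁻¹.toWord = q⁻¹.toWord ++ p.toWord := by
    have : r⁻¹ = q⁻¹ * p := by rw [hr]; group
    rw [this]
    exact word_nocancel (fun c hc hc2 => hpq c hc2 hc)
  have hr1 : hdw r = hdw p⁻¹ := by
    obtain ⟨c, hc⟩ := hdw_ne_none (inv_ne_one.2 hp1)
    unfold hdw at *
    rw [hrw, List.head?_append, hc]; rfl
  have hrne : r ≠ 1 := by
    intro h; rw [h] at hrw; rw [FreeGroup.toWord_one, eq_comm, List.append_eq_nil_iff, FreeGroup.toWord_eq_nil_iff] at hrw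
    exact hp1 (inv_eq_one.1 hrw.1)
  have hr2 : hdw r⁻¹ ≠ hdw z' ∧ hdw r⁻¹ ≠ hdw z'⁻¹ := by
    by_cases hq1 : q = 1
    · have e : hdw r⁻¹ = hdw y := by rw [p3, hr, hq1]; simp
      have ez : z' = z := by rw [hzq, hq1]; simp
      rw [e, ez]; exact ⟨h1, h2⟩
    · obtain ⟨q1, q2, q3, q4⟩ := hq hq1
      have e : hdw r⁻¹ = hdw q⁻¹ := by
        obtain ⟨c, hc⟩ := hdw_ne_none (inv_ne_one.2 hq1)
        unfold hdw at *
        rw [hri, List.head?_append, hc]; rfl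
      rw [e]; exact ⟨q1, q2⟩
  have s1 : hdw r ≠ hdw y' := by rw [hr1]; exact p1
  have s2 : hdw r ≠ hdw y'⁻¹ := by rw [hr1]; exact p2
  obtain ⟨s3, s4⟩ := hr2
  have hs' : Function.Surjective (hom2 y' (r * z' * r⁻¹)) := by
    have := hom2_conj p⁻¹ y z
    have e1 : p⁻¹ * y * p⁻¹⁻¹ = y' := by rw [hyp]; group
    have e2 : p⁻¹ * z * p⁻¹⁻¹ = r * z' * r⁻¹ := by rw [hzq, hr]; group
    rw [e1, e2] at this
    rw [this]
    exact (inn_surj _).comp hs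
  let G : FGraph (Fin 3 × Bool) Bool := mkG ![false, true, false] ![false, true, true] ![y', z', r]
    (by intro i; fin_cases i <;> simp [hy1, hz1, hrne])
    (by
      have := s1.symm; have := s2.symm; have := s3.symm; have := s4.symm
      have := hyh.symm; have := hzh.symm
      clear hs hs' p1 p2 p3 p4 hpq hp1 hq hp h1 h2 h5 hr1 hrne hrw hri hyp hzq hy hz hr
      clear_value r
      rintro ⟨i, a⟩ ⟨j, b⟩
      fin_cases i <;> fin_cases j <;> cases a <;> cases b <;> simp_all [srE, lbE])
  have key : ∀ g : F2, g.norm = 1 → g = y' ∨ g = y'⁻¹ := by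
    intro g hg
    obtain ⟨e, k1, k2, h⟩ := G.norm_one_edge {y', r * z' * r⁻¹} false (by
      intro s hs
      rcases hs with rfl | rfl
      · exact ⟨[(0, true)], by simp [FGraph.IsPath, G, mkG, srE], by simp [FGraph.val, G, mkG, lbE]⟩
      · exact ⟨[(2, true), (1, true), (2, false)], by simp [FGraph.IsPath, G, mkG, srE],
          by simp [FGraph.val, G, mkG, lbE, mul_assoc]⟩)
      g (surj_closure hs' g) hg
    rcases e with ⟨i, b⟩
    fin_cases i <;> cases b <;> simp [G, mkG, lbE, srE] at h k1 k2 <;> simp [← h]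
  have n1 := ga_ne_gb
  have n2 := ga_ne_gb'
  rcases key ga (by simp) with h1 | h1 <;> rcases key gb (by simp) with h2 | h2
  · exact n1 (h1.trans h2.symm)
  · exact n2 (by rw [h1, h2]; simp)
  · exact n2 (by rw [h1, h2])
  · exact n1 (by rw [h1, h2])

lemma Th_one {y z : F2} : Th 1 y z ↔ GW y z := by simp [Th]

theorem nielsen : ∀ (n : ℕ) (x y z : F2), x.norm + y.norm + z.norm = n → Th x y z := by
  intro n
  induction n using Nat.strong_induction_on with
  | _ n IH =>
  have ih : ∀ x y z : F2, x.norm + y.norm + z.norm < n → Th x y z :=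
    fun x y z h => IH _ h x y z rfl
  have t1 : ∀ x y z : F2, x.norm + y.norm + z.norm ≤ n → x ≠ 1 → hdw x = hdw y → Th x y z := by
    intro x y z hn hx h
    obtain ⟨c, hc⟩ := hdw_ne_none hx
    exact T1 ih hn hc (by rw [← h, hc])
  have t2 : ∀ x y z : F2, x.norm + y.norm + z.norm ≤ n → x ≠ 1 → hdw x⁻¹ = hdw y⁻¹ → Th x y z := by
    intro x y z hn hx h
    obtain ⟨c, hc⟩ := hdw_ne_none (inv_ne_one.2 hx)
    exact T2 ih hn hc (by rw [← h, hc])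
  have P : ∀ y z : F2, y.norm + z.norm ≤ n → GW y z := by
    intro y z hn
    by_cases hy : y = 1
    · subst hy; exact one_case z
    by_cases hz : z = 1
    · subst hz; exact (one_case y).swap
    by_cases h1 : hdw y = hdw z
    · exact Th_one.1 (Th.rot (Th.swap (t1 _ _ _ (by simp; omega) hy h1)))
    by_cases h2 : hdw y⁻¹ = hdw z⁻¹
    · exact Th_one.1 (Th.rot (Th.swap (t2 _ _ _ (by simp; omega) hy h2)))
    by_cases h3 : hdw y⁻¹ = hdw z
    · exact GW.inv (Th_one.1 (Th.rot (Th.swap (t1 _ _ _ (by simp; omega) (inv_ne_one.2 hy) h3))))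
    by_cases h4 : hdw y = hdw z⁻¹
    · exact GW.inv (Th_one.1 (Th.rot (Th.swap (t2 _ _ _ (by simp; omega) (inv_ne_one.2 hy) (by simpa using h4)))))
    by_cases h5 : hdw y = hdw y⁻¹
    · exact barbell_case hy hz h1 h4 h5
    by_cases h6 : hdw z = hdw z⁻¹
    · exact (barbell_case hz hy (Ne.symm h1) (Ne.symm h3) h6).swap
    exact rose_case hy hz h1 h4 h3 h2 h5 h6
  intro x y z hn
  by_cases hx : x = 1
  · subst hx; exact Th_one.2 (P _ _ (by simp at hn; omega))
  by_cases hy : y = 1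
  · subst hy; exact Th.rot (Th_one.2 (P _ _ (by simp at hn; omega)))
  by_cases hz : z = 1
  · subst hz; exact Th.swap (Th.rot (Th_one.2 (P _ _ (by simp at hn; omega))))
  by_cases h1 : hdw x = hdw y
  · exact t1 _ _ _ (by omega) hx h1
  by_cases h2 : hdw x = hdw z
  · exact Th.swap (t1 _ _ _ (by omega) hx h2)
  by_cases h3 : hdw y = hdw z
  · exact Th.rot (Th.swap (t1 _ _ _ (by omega) hy h3))
  by_cases k1 : hdw x⁻¹ = hdw y⁻¹
  · exact t2 _ _ _ (by omega) hx k1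
  by_cases k2 : hdw x⁻¹ = hdw z⁻¹
  · exact Th.swap (t2 _ _ _ (by omega) hx k2)
  by_cases k3 : hdw y⁻¹ = hdw z⁻¹
  · exact Th.rot (Th.swap (t2 _ _ _ (by omega) hy k3))
  exact theta_case hx hy hz h1 h2 h3 k1 k2 k3

theorem aut_X (ψ : F2 ≃* F2) : ∃ c D1 l D2, Sg D1 ∧ Sg D2 ∧
    ∀ w, ψ w = c * D1 (Ph l (D2 w)) * c⁻¹ := by
  have e : hom2 (ψ ga) (ψ gb) = ψ.toMonoidHom := hom_ext2 (by simp) (by simp)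
  have h : XX (ψ ga) (ψ gb) :=
    Th_one.1 (nielsen _ 1 (ψ ga) (ψ gb) rfl) (by rw [e]; exact ψ.surjective)
  unfold XX at h
  rw [e] at h
  exact h

end

section
def pw (s : Bool) (z : F2) : F2 := if s then z else z⁻¹

@[simp] lemma pw_true (z : F2) : pw true z = z := rfl
@[simp] lemma pw_false (z : F2) : pw false z = z⁻¹ := rfl

inductive Pa (A : Bool → ℤ → Bool → Prop) : Bool → Bool → F2 → Prop
  | nil (σ : Bool) : Pa A σ σ 1
  | snoc {σ τ δ : Bool} {w : F2} {k : ℤ} : Pa A σ τ w → A τ k δ → Pa A σ δ (w * ga ^ k * pw δ gb)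

lemma Pa.append {A : Bool → ℤ → Bool → Prop} {σ τ ρ : Bool} {w v : F2} (h : Pa A σ τ w)
    (k : Pa A τ ρ v) : Pa A σ ρ (w * v) := by
  induction k with
  | nil => simpa using h
  | snoc _ h2 ih => simpa [mul_assoc] using Pa.snoc ih h2

lemma Pa.single {A : Bool → ℤ → Bool → Prop} {τ δ : Bool} {k : ℤ} (h : A τ k δ) :
    Pa A τ δ (ga ^ k * pw δ gb) := by
  simpa using Pa.snoc (Pa.nil τ) h

lemma Pa.mono {A B : Bool → ℤ → Bool → Prop} (hAB : ∀ τ k δ, A τ k δ → B τ k δ) {σ τ : Bool} {w : F2}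
    (h : Pa A σ τ w) : Pa B σ τ w := by
  induction h with
  | nil => exact Pa.nil _
  | snoc _ h2 ih => exact Pa.snoc ih (hAB _ _ _ h2)

def AD (l : ℕ) : Bool → ℤ → Bool → Prop
  | true, k, true => k ≤ l + 1
  | false, k, false => k ≤ -l
  | _, k, _ => k ≤ -1

def Ainf : Bool → ℤ → Bool → Prop
  | true, _, true => True
  | false, _, false => False
  | _, k, _ => k ≤ -1

def Asrc : Bool → ℤ → Bool → Prop
  | true, _, true => True
  | false, k, false => k ≤ -1
  | _, k, _ => k ≤ -1

def ATT : Bool → ℤ → Bool → Prop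
  | true, k, true => 1 ≤ k
  | false, k, false => -2 ≤ k
  | _, k, _ => 1 ≤ k

def Mon (ε δ : Bool) : Submonoid F2 := Submonoid.closure {pw ε ga, pw δ gb}

def Kbase (z : F2) : Prop :=
  (∃ ε δ, z ∈ Mon ε δ) ∨ (∃ l : ℕ, 1 ≤ l ∧ ∃ σ, Pa (AD l) σ σ z) ∨ ∃ σ, Pa Ainf σ σ z

def K (w : F2) : Prop := ∃ (t s : Bool) (c z : F2), Kbase z ∧
  w = c * (if t then MonoidHom.id F2 else sW) (pw s z) * c⁻¹

lemma Kbase.K {z : F2} (h : Kbase z) : K z := ⟨true, true, 1, z, h, by simp⟩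

lemma K.conj {w : F2} (h : K w) (g : F2) : K (g * w * g⁻¹) := by
  obtain ⟨t, s, c, z, h, rfl⟩ := h
  exact ⟨t, s, g * c, z, h, by simp [mul_assoc]⟩

lemma K.of_conj {w : F2} (g : F2) (h : K (g * w * g⁻¹)) : K w := by
  simpa [mul_assoc] using h.conj g⁻¹

lemma K.inv {w : F2} (h : K w) : K w⁻¹ := by
  obtain ⟨t, s, c, z, h, rfl⟩ := h
  refine ⟨t, !s, c, z, h, ?_⟩
  cases s <;> simp [mul_assoc]

lemma sW_sW (w : F2) : sW (sW w) = w := by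
  have : sW.comp sW = MonoidHom.id F2 := hom_ext2 (by simp [sW]) (by simp [sW])
  exact DFunLike.congr_fun this w

lemma K.sW {w : F2} (h : K w) : K (sW w) := by
  obtain ⟨t, s, c, z, h, rfl⟩ := h
  refine ⟨!t, s, _root_.sW c, z, h, ?_⟩
  cases t <;> simp [sW_sW]

/-- gauge transformation -/
lemma Pa.gauge {A B : Bool → ℤ → Bool → Prop} (φ : F2 →* F2) (h : Bool → F2)
    (hs : ∀ τ k δ, A τ k δ → ∃ k', B τ k' δ ∧ h τ * φ (ga ^ k * pw δ gb) * (h δ)⁻¹ = ga ^ k' * pw δ gb)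
    {σ τ : Bool} {w : F2} (hw : Pa A σ τ w) : Pa B σ τ (h σ * φ w * (h τ)⁻¹) := by
  induction hw with
  | nil => simpa using Pa.nil _
  | @snoc τ δ w k _ h2 ih =>
    obtain ⟨k', h3, h4⟩ := hs _ _ _ h2
    have := Pa.append ih (Pa.single h3)
    rw [← h4] at this
    simpa [mul_assoc] using this

def gau : Bool → F2
  | true => 1
  | false => ga⁻¹

lemma gau_step (τ : Bool) (k : ℤ) (δ : Bool) :
    gau τ * el true true (ga ^ k * pw δ gb) * (gau δ)⁻¹ =
      ga ^ (k + (if τ = δ then (if δ then 1 else -1) else 0)) * pw δ gb := by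
  cases τ <;> cases δ <;> simp [gau, el, zpow_add, mul_assoc]
  · rw [← mul_assoc, ← mul_assoc, ← zpow_neg_one, ← zpow_add, ← zpow_add, add_comm]
  · rw [← mul_assoc, ← mul_assoc, ← zpow_neg_one, ← zpow_add, ← zpow_add_one]
    congr 2; omega

lemma e_AD {l : ℕ} {σ : Bool} {z : F2} (h : Pa (AD l) σ σ z) : K (el true true z) := by
  apply K.of_conj (gau σ)
  apply Kbase.K
  refine Or.inr (Or.inl ⟨l + 1, by omega, σ, ?_⟩)
  refine Pa.gauge _ _ ?_ h
  intro τ k δ hA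
  refine ⟨_, ?_, gau_step τ k δ⟩
  cases τ <;> cases δ <;> simp [AD] at * <;> omega

lemma e_Ainf {σ : Bool} {z : F2} (h : Pa Ainf σ σ z) : K (el true true z) := by
  apply K.of_conj (gau σ)
  apply Kbase.K
  refine Or.inr (Or.inr ⟨σ, ?_⟩)
  refine Pa.gauge _ _ ?_ h
  intro τ k δ hA
  refine ⟨_, ?_, gau_step τ k δ⟩
  cases τ <;> cases δ <;> simp [Ainf] at * <;> omega

/-- the closure case -/
lemma mon_path {z : F2} (h : z ∈ Submonoid.closure ({ga, ga⁻¹, gb} : Set F2)) :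
    (∃ m : ℤ, z = ga ^ m) ∨ ∃ n : ℤ, ∀ m : ℤ, Pa Ainf true true (ga ^ m * z * ga ^ n) := by
  induction h using Submonoid.closure_induction_right with
  | one => exact Or.inl ⟨0, by simp⟩
  | mul_right x hx y hy ih =>
    have key : ∀ i : ℤ, y = ga ^ i → (∃ m : ℤ, x * y = ga ^ m) ∨
        ∃ n : ℤ, ∀ m : ℤ, Pa Ainf true true (ga ^ m * (x * y) * ga ^ n) := by
      rintro i rfl
      rcases ih with ⟨m, rfl⟩ | ⟨n, hn⟩
      · exact Or.inl ⟨m + i, by rw [zpow_add]⟩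
      · refine Or.inr ⟨n - i, fun m => ?_⟩
        have := hn m
        have e : ga ^ m * (x * ga ^ i) * ga ^ (n - i) = ga ^ m * x * ga ^ n := by group
        rwa [e]
    rcases hy with rfl | rfl | rfl
    · exact key 1 (by simp)
    · exact key (-1) (by simp)
    · right
      refine ⟨0, fun m => ?_⟩
      rcases ih with ⟨m', rfl⟩ | ⟨n, hn⟩
      · have := Pa.single (A := Ainf) (τ := true) (δ := true) (k := m + m') (by simp [Ainf])
        simpa [zpow_add, mul_assoc] using this
      · have := (hn m).append (Pa.single (A := Ainf) (τ := true) (δ := true) (k := -n) (by simp [Ainf]))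
        simpa [mul_assoc] using this

lemma K_zpow (m : ℤ) : K (ga ^ m) := by
  have h : ∀ n : ℕ, K (ga ^ n) := fun n =>
    Kbase.K (Or.inl ⟨true, true, Submonoid.pow_mem _ (Submonoid.subset_closure (by simp)) n⟩)
  obtain ⟨n, rfl | rfl⟩ := m.eq_nat_or_neg
  · simpa using h n
  · simpa using (h n).inv

lemma K_mon3 {z : F2} (h : z ∈ Submonoid.closure ({ga, ga⁻¹, gb} : Set F2)) : K z := by
  rcases mon_path h with ⟨m, rfl⟩ | ⟨n, hn⟩
  · exact K_zpow m
  · apply K.of_conj (ga ^ (-n))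
    refine Kbase.K (Or.inr (Or.inr ⟨true, ?_⟩))
    simpa using hn (-n)

lemma map_closure {φ : F2 →* F2} {S : Set F2} {T : Submonoid F2} (h : ∀ s ∈ S, φ s ∈ T) {z : F2}
    (hz : z ∈ Submonoid.closure S) : φ z ∈ T := by
  have : Submonoid.closure S ≤ T.comap φ := (Submonoid.closure_le).2 h
  exact this hz

lemma inv_closure2 {u v : F2} {z : F2} (h : z ∈ Submonoid.closure ({u, v} : Set F2)) :
    z⁻¹ ∈ Submonoid.closure ({u⁻¹, v⁻¹} : Set F2) := by
  induction h using Submonoid.closure_induction_right with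
  | one => simp
  | mul_right x hx y hy ih =>
    rw [mul_inv_rev]
    refine Submonoid.mul_mem _ (Submonoid.subset_closure ?_) ih
    rcases hy with rfl | rfl <;> simp

lemma e_Mon {ε δ : Bool} {z : F2} (h : z ∈ Mon ε δ) : K (el true true z) := by
  have key : ∀ ε z, z ∈ Mon ε true → K (el true true z) := by
    intro ε z h
    apply K_mon3
    refine map_closure ?_ h
    have m1 : ga ∈ Submonoid.closure ({ga, ga⁻¹, gb} : Set F2) := Submonoid.subset_closure (by simp)
    have m2 : ga⁻¹ ∈ Submonoid.closure ({ga, ga⁻¹, gb} : Set F2) := Submonoid.subset_closure (by simp)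
    have m3 : gb ∈ Submonoid.closure ({ga, ga⁻¹, gb} : Set F2) := Submonoid.subset_closure (by simp)
    rintro s (rfl | rfl)
    · cases ε
      · simpa [el] using m2
      · simpa [el] using m1
    · simpa [el] using mul_mem m1 m3
  cases δ
  · have := key (!ε) z⁻¹ (by
      have := inv_closure2 h
      unfold Mon
      cases ε <;> simpa using this)
    simpa using this.inv
  · exact key _ _ h

lemma sW_Mon {ε δ : Bool} {z : F2} (h : z ∈ Mon ε δ) : sW z ∈ Mon δ ε := by
  refine map_closure ?_ h
  rintro s (rfl | rfl)
  · refine Submonoid.subset_closure (Or.inr ?_)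
    cases ε <;> simp [sW]
  · refine Submonoid.subset_closure (Or.inl ?_)
    cases δ <;> simp [sW]

def th : F2 →* F2 := (el true true).comp sW
lemma th_a : th ga = ga * gb := by simp [th, sW, el]
lemma th_b : th gb = ga := by simp [th, sW, el]

/-- pending state -/
def PV : Bool → Bool → ℤ → Prop
  | true, true, j => 1 ≤ j
  | true, false, j => 0 ≤ j
  | false, false, j => j = -2
  | false, true, _ => False

lemma rep_pos (n : ℕ) (j : ℤ) (σ : Bool) (h : PV true σ j) :
    Pa ATT σ true (ga ^ j * (ga * gb) ^ (n + 1)) := by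
  induction n with
  | zero =>
    have := Pa.single (A := ATT) (τ := σ) (δ := true) (k := j + 1)
      (by cases σ <;> simp [ATT, PV] at * <;> omega)
    simpa [zpow_add, mul_assoc] using this
  | succ n ih =>
    have := ih.append (Pa.single (A := ATT) (τ := true) (δ := true) (k := 1) (by simp [ATT]))
    simpa [pow_succ, mul_assoc] using this

lemma rep_neg (n : ℕ) (ε : Bool) (j : ℤ) (σ : Bool) (h : PV ε σ j) :
    Pa ATT σ false (ga ^ j * ((ga * gb)⁻¹) ^ (n + 1) * ga) := by
  induction n with
  | zero =>
    have := Pa.single (A := ATT) (τ := σ) (δ := false) (k := j)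
      (by cases ε <;> cases σ <;> simp [ATT, PV] at * <;> omega)
    simpa [mul_assoc] using this
  | succ n ih =>
    have := ih.append (Pa.single (A := ATT) (τ := false) (δ := false) (k := -1) (by simp [ATT]))
    rw [pow_succ]
    simpa [mul_assoc] using this

lemma th_step {ε δ : Bool} {k : ℤ} (h : Asrc ε k δ) (h0 : ¬ (ε = true ∧ δ = true ∧ k = 0)) :
    ∃ σ' j', PV δ σ' j' ∧ ∀ σ j, PV ε σ j →
      Pa ATT σ σ' (ga ^ j * th (ga ^ k * pw δ gb) * ga ^ (-j')) := by
  by_cases hk : 1 ≤ k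
  · have hh : ε = true ∧ δ = true := by cases ε <;> cases δ <;> simp [Asrc] at * <;> omega
    obtain ⟨rfl, rfl⟩ := hh
    obtain ⟨n, rfl⟩ : ∃ n : ℕ, k = (n : ℤ) + 1 := ⟨(k - 1).toNat, by omega⟩
    refine ⟨true, 1, by simp [PV], fun σ j hj => ?_⟩
    have := rep_pos n j σ hj
    have e : ga ^ j * th (ga ^ ((n : ℤ) + 1) * pw true gb) * ga ^ (-1 : ℤ) = ga ^ j * (ga * gb) ^ (n + 1) := by
      rw [map_mul, map_zpow, th_a, pw_true, th_b]
      have : ((n : ℤ) + 1) = ((n + 1 : ℕ) : ℤ) := by simp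
      rw [this, zpow_natCast]
      group
    rwa [e]
  · have hk : k ≤ -1 := by cases ε <;> cases δ <;> simp [Asrc] at * <;> omega
    obtain ⟨n, rfl⟩ : ∃ n : ℕ, k = -((n : ℤ) + 1) := ⟨(-k - 1).toNat, by omega⟩
    have e0 : (ga * gb) ^ (-((n : ℤ) + 1)) = ((ga * gb)⁻¹) ^ (n + 1) := by
      have : ((n : ℤ) + 1) = ((n + 1 : ℕ) : ℤ) := by simp
      rw [this, zpow_neg, zpow_natCast, inv_pow]
    cases δ with
    | true =>
      refine ⟨false, 0, by simp [PV], fun σ j hj => ?_⟩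
      have := rep_neg n ε j σ hj
      rw [map_mul, map_zpow, th_a, pw_true, th_b, e0]
      simpa [mul_assoc] using this
    | false =>
      refine ⟨false, -2, by simp [PV], fun σ j hj => ?_⟩
      have := rep_neg n ε j σ hj
      rw [map_mul, map_zpow, th_a, pw_false, map_inv, th_b, e0]
      have e1 : ∀ g : F2, g * ga⁻¹ * ga ^ (- -2 : ℤ) = g * ga := by intro g; group
      rw [← mul_assoc (ga ^ j), e1]
      exact this

lemma th_path {ε δ : Bool} {w : F2} (h : Pa Asrc ε δ w) :
    (∃ n : ℕ, w = gb ^ n ∧ ε = δ ∧ (n = 0 ∨ ε = true)) ∨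
    ∃ σ1 j1, PV δ σ1 j1 ∧ ∀ σ0 j0, PV ε σ0 j0 → Pa ATT σ0 σ1 (ga ^ j0 * th w * ga ^ (-j1)) := by
  induction h with
  | nil => exact Or.inl ⟨0, by simp⟩
  | @snoc τ δ w k hp hA ih =>
    by_cases h0 : τ = true ∧ δ = true ∧ k = 0
    · obtain ⟨rfl, rfl, rfl⟩ := h0
      rcases ih with ⟨n, rfl, rfl, hn⟩ | ⟨σ1, j1, hV, ih⟩
      · exact Or.inl ⟨n + 1, by simp [pow_succ], rfl, Or.inr rfl⟩
      · refine Or.inr ⟨σ1, j1 + 1, ?_, fun σ0 j0 h => ?_⟩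
        · cases σ1 <;> simp [PV] at * <;> omega
        · have := ih σ0 j0 h
          have e : ga ^ j0 * th (w * ga ^ (0 : ℤ) * pw true gb) * ga ^ (-(j1 + 1)) =
              ga ^ j0 * th w * ga ^ (-j1) := by
            simp only [map_mul, zpow_zero, map_one, pw_true, th_b]; group
          rwa [e]
    · obtain ⟨σ', j', hV', hst⟩ := th_step hA h0
      right
      refine ⟨σ', j', hV', fun σ0 j0 h => ?_⟩
      rcases ih with ⟨n, rfl, rfl, hn⟩ | ⟨σ1, j1, hV, ih⟩
      · have hh : PV ε σ0 (j0 + n) := by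
          rcases hn with rfl | rfl
          · simpa using h
          · cases σ0 <;> simp [PV] at * <;> omega
        have := hst _ _ hh
        rw [mul_assoc (gb ^ n), map_mul, map_pow, th_b, ← mul_assoc, ← zpow_natCast, ← zpow_add]
        exact this
      · have := (ih _ _ h).append (hst _ _ hV)
        rw [mul_assoc w, map_mul]
        have e : ∀ u v : F2, ga ^ j0 * u * ga ^ (-j1) * (ga ^ j1 * v * ga ^ (-j')) =
          ga ^ j0 * (u * v) * ga ^ (-j') := by intro u v; group
        rwa [e] at this

lemma TT_inv {σ τ : Bool} {w : F2} (h : Pa ATT σ τ w) :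
    Pa (AD 1) (!τ) (!σ) (pw τ gb * w⁻¹ * (pw σ gb)⁻¹) := by
  induction h with
  | nil => simpa using Pa.nil _
  | @snoc τ δ w k hp hA ih =>
    have := (Pa.single (A := AD 1) (τ := !δ) (δ := !τ) (k := -k)
      (by cases τ <;> cases δ <;> simp [ATT, AD] at * <;> omega)).append ih
    have e : pw δ gb * (w * ga ^ k * pw δ gb)⁻¹ * (pw σ gb)⁻¹ =
       ga ^ (-k) * pw (!τ) gb * (pw τ gb * w⁻¹ * (pw σ gb)⁻¹) := by
      cases τ <;> simp [mul_assoc]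
    rwa [e]

lemma th_loop {σ : Bool} {z : F2} (h : Pa Asrc σ σ z) : K (th z) := by
  rcases th_path h with ⟨n, rfl, -, -⟩ | ⟨σ1, j1, hV, h⟩
  · have := K_zpow n
    simpa [th_b] using this
  · have := TT_inv (h σ1 j1 hV)
    have h2 : K (pw σ1 gb * (ga ^ j1 * th z * ga ^ (-j1))⁻¹ * (pw σ1 gb)⁻¹) :=
      Kbase.K (Or.inr (Or.inl ⟨1, le_rfl, _, this⟩))
    have h3 := (K.of_conj _ h2).inv
    apply K.of_conj (ga ^ j1)
    simpa using h3

lemma K.e {w : F2} (h : K w) : K (el true true w) := by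
  obtain ⟨t, s, c, z, h, rfl⟩ := h
  rw [map_mul, map_mul, map_inv]
  apply K.conj
  have : ∀ φ : F2 →* F2, K (φ z) → K (φ (pw s z)) := by
    intro φ h
    cases s
    · simpa using h.inv
    · simpa using h
  cases t with
  | true =>
    apply this
    rcases h with ⟨ε, δ, h⟩ | ⟨l, hl, σ, h⟩ | ⟨σ, h⟩
    · exact e_Mon h
    · exact e_AD h
    · exact e_Ainf h
  | false =>
    apply this th
    rcases h with ⟨ε, δ, h⟩ | ⟨l, hl, σ, h⟩ | ⟨σ, h⟩
    · exact e_Mon (sW_Mon h)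
    · refine th_loop (h.mono ?_)
      intro τ k δ
      cases τ <;> cases δ <;> simp [AD, Asrc] <;> omega
    · refine th_loop (h.mono ?_)
      intro τ k δ
      cases τ <;> cases δ <;> simp [Ainf, Asrc]

lemma K.f {w : F2} (h : K w) : K (el false true w) := by
  have : el false true = _root_.sW.comp ((el true true).comp _root_.sW) :=
    hom_ext2 (by simp [el, _root_.sW]) (by simp [el, _root_.sW])
  rw [this]
  exact h.sW.e.sW

lemma K.Ph {w : F2} (l : List Bool) (h : K w) : K (Ph l w) := by
  induction l generalizing w with
  | nil => exact h
  | cons x l ih =>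
    cases x
    · exact ih h.f
    · exact ih h.e

def Dx (t ε δ : Bool) : F2 →* F2 :=
  if t then hom2 (pw ε ga) (pw δ gb) else hom2 (pw δ gb) (pw ε ga)

lemma Sg_Dx {D : F2 →* F2} (h : Sg D) : ∃ t ε δ, D = Dx t ε δ := by
  induction h with
  | id => exact ⟨true, true, true, hom_ext2 (by simp [Dx]) (by simp [Dx])⟩
  | a _ ih =>
    obtain ⟨t, ε, δ, rfl⟩ := ih
    cases t
    · exact ⟨false, ε, !δ, hom_ext2 (by cases δ <;> simp [Dx, sA]) (by cases δ <;> simp [Dx, sA])⟩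
    · exact ⟨true, !ε, δ, hom_ext2 (by cases ε <;> simp [Dx, sA]) (by cases ε <;> simp [Dx, sA])⟩
  | b _ ih =>
    obtain ⟨t, ε, δ, rfl⟩ := ih
    cases t
    · exact ⟨false, !ε, δ, hom_ext2 (by cases ε <;> simp [Dx, sB]) (by cases ε <;> simp [Dx, sB])⟩
    · exact ⟨true, ε, !δ, hom_ext2 (by cases δ <;> simp [Dx, sB]) (by cases δ <;> simp [Dx, sB])⟩
  | w _ ih =>
    obtain ⟨t, ε, δ, rfl⟩ := ih
    exact ⟨!t, ε, δ, hom_ext2 (by cases t <;> simp [Dx, sW]) (by cases t <;> simp [Dx, sW])⟩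

lemma K_pos {D : F2 →* F2} (h : Sg D) {p : F2} (hp : Positive2 p) : K (D p) := by
  obtain ⟨t, ε, δ, rfl⟩ := Sg_Dx h
  apply Kbase.K
  refine Or.inl ⟨ε, δ, map_closure ?_ hp⟩
  rintro s ⟨i, rfl⟩
  refine Submonoid.subset_closure ?_
  fin_cases i <;> cases t <;> simp [Dx]

theorem PP_form {w : F2} (h : PotPos2 w) : ∃ t ε δ s c z, Kbase z ∧
    w = c * Dx t ε δ (pw s z) * c⁻¹ := by
  obtain ⟨φ, hp⟩ := h
  obtain ⟨c, D1, l, D2, h1, h2, h3⟩ := aut_X φ.symm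
  have e := h3 (φ w)
  rw [MulEquiv.symm_apply_apply] at e
  obtain ⟨t, s, d, z, hz, e2⟩ := K.Ph l (K_pos h2 hp)
  rw [e2] at e
  cases t with
  | true =>
    obtain ⟨t, ε, δ, rfl⟩ := Sg_Dx h1
    refine ⟨t, ε, δ, s, c * Dx t ε δ d, z, hz, ?_⟩
    rw [e]; simp [mul_assoc]
  | false =>
    obtain ⟨t, ε, δ, h4⟩ := Sg_Dx (h1.comp Sg.sW)
    refine ⟨t, ε, δ, s, c * D1 d, z, hz, ?_⟩
    rw [e, ← h4]; simp [mul_assoc]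

end

section
abbrev Lt := Fin 2 × Bool

def CR (L : List Lt) : Prop := FreeGroup.IsCyclicallyReduced L

lemma CR_iff (L : List Lt) : CR L ↔ FreeGroup.IsReduced (L ++ L) := by
  unfold CR FreeGroup.IsReduced
  rw [FreeGroup.isCyclicallyReduced_iff, List.isChain_append]
  unfold FreeGroup.IsReduced
  tauto

lemma cyc_iff (w : F2) : CyclicallyReduced2 w ↔ CR w.toWord := by
  unfold CR CyclicallyReduced2
  rw [FreeGroup.isCyclicallyReduced_iff]
  simp only [FreeGroup.isReduced_toWord, true_and]
  constructor
  · intro h a ha b hb hab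
    have := h b hb a ha
    by_contra hne
    apply this
    ext1
    · exact hab.symm
    · simp; cases h1 : a.2 <;> cases h2 : b.2 <;> simp_all
  · intro h x hx y hy hxy
    have := h y hy x hx
    rw [hxy] at this
    simp at this

lemma CR_rot1 (c : Lt) (Z : List Lt) : CR (c :: Z) → CR (Z ++ [c]) := by
  rw [CR_iff, CR_iff]
  unfold FreeGroup.IsReduced
  intro h
  have h1 : List.IsChain (fun a b : Lt ↦ a.1 = b.1 → a.2 = b.2) (Z ++ [c]) :=
    red_sub h ⟨[c], Z, by simp⟩
  rw [List.isChain_append]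
  refine ⟨h1, h1, ?_⟩
  intro x hx y hy
  simp at hx
  subst hx
  rcases Z with _ | ⟨d, Z⟩
  · simp at hy; subst hy; simp
  · simp at hy; subst hy
    simp at h
    exact h.1

lemma CR_rot2 (c : Lt) (Z : List Lt) : CR (Z ++ [c]) → CR (c :: Z) := by
  rw [CR_iff, CR_iff]
  unfold FreeGroup.IsReduced
  intro h
  have h1 : List.IsChain (fun a b : Lt ↦ a.1 = b.1 → a.2 = b.2) (c :: Z) :=
    red_sub h ⟨Z, [c], by simp⟩
  rw [List.isChain_append]
  refine ⟨h1, h1, ?_⟩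
  intro x hx y hy
  simp at hy
  subst hy
  rw [List.isChain_append] at h
  rcases Z.eq_nil_or_concat with rfl | ⟨Z, d, rfl⟩
  · simp at hx; subst hx; simp
  · rw [List.concat_eq_append, ← List.cons_append, List.getLast?_concat] at hx
    simp at hx
    subst hx
    have := h.1
    rw [List.concat_eq_append, List.isChain_append] at this
    exact this.2.2 d (by simp) c (by simp)

lemma rot_lemma (G : List Lt) : FreeGroup.IsReduced G → ∀ Z W : List Lt, CR Z → Z ≠ [] → CR W →
    FreeGroup.mk W = FreeGroup.mk G * FreeGroup.mk Z * (FreeGroup.mk G)⁻¹ → W ~r Z := by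
  induction G using List.reverseRecOn with
  | nil =>
    intro _ Z W hZ _ hW h
    have : FreeGroup.mk ([] : List Lt) = 1 := rfl
    rw [this] at h
    simp only [one_mul, inv_one, mul_one] at h
    have h2 := congrArg FreeGroup.toWord h
    rw [FreeGroup.toWord_mk, FreeGroup.toWord_mk, hW.1.reduce_eq, hZ.1.reduce_eq] at h2
    rw [h2]
  | append_singleton G c ih =>
    intro hG Z W hZ hne hW h
    have hG' : FreeGroup.IsReduced G := red_sub hG ⟨[], [c], by simp⟩
    have hc : FreeGroup.mk (G ++ [c]) = FreeGroup.mk G * FreeGroup.mk [c] := by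
      rw [FreeGroup.mul_mk]
    have hci : FreeGroup.mk [(c.1, !c.2)] = (FreeGroup.mk [c])⁻¹ := by
      rw [FreeGroup.inv_mk]; simp [FreeGroup.invRev]
    by_cases h1 : Z.head? = some (c.1, !c.2)
    · rcases Z with _ | ⟨d, Z⟩
      · simp at h1
      · simp at h1
        subst h1
        have := ih hG' (Z ++ [(c.1, !c.2)]) W (CR_rot1 _ _ hZ) (by simp) hW (by
          rw [h, hc, ← FreeGroup.mul_mk, hci]
          have : FreeGroup.mk ((c.1, !c.2) :: Z) = (FreeGroup.mk [c])⁻¹ * FreeGroup.mk Z := by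
            rw [← hci, FreeGroup.mul_mk]; rfl
          rw [this]; group)
        exact this.trans (List.IsRotated.cons_append_singleton).symm
    by_cases h2 : Z.getLast? = some c
    · rcases Z.eq_nil_or_concat with rfl | ⟨Z, d, rfl⟩
      · simp at h2
      · simp at h2
        subst h2
        rw [List.concat_eq_append] at *
        have := ih hG' (d :: Z) W (CR_rot2 _ _ hZ) (by simp) hW (by
          rw [h, hc, ← FreeGroup.mul_mk]
          have : FreeGroup.mk (d :: Z) = FreeGroup.mk [d] * FreeGroup.mk Z := by
            rw [FreeGroup.mul_mk]; rfl
          rw [this]; group)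
        exact this.trans List.IsRotated.cons_append_singleton
    exfalso
    have hred : FreeGroup.IsReduced (G ++ [c] ++ (Z ++ FreeGroup.invRev (G ++ [c]))) := by
      have e : FreeGroup.invRev (G ++ [c]) = (c.1, !c.2) :: FreeGroup.invRev G := by
        simp [FreeGroup.invRev]
      have hi : FreeGroup.IsReduced (FreeGroup.invRev (G ++ [c])) := by
        have := FreeGroup.isReduced_toWord (x := (FreeGroup.mk (G ++ [c]))⁻¹)
        rwa [FreeGroup.toWord_inv, FreeGroup.toWord_mk, hG.reduce_eq] at this
      unfold FreeGroup.IsReduced at *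
      rw [List.isChain_append, List.isChain_append (l₁ := Z)]
      refine ⟨hG, ⟨hZ.1, hi, ?_⟩, ?_⟩
      · intro x hx y hy hxy
        rw [e] at hy
        simp at hy
        subst hy
        by_contra hne
        apply h2
        rw [Option.mem_def] at hx
        rw [hx]
        congr 1
        ext1
        · exact hxy
        · simpa using hne
      · intro x hx y hy hxy
        simp at hx
        subst hx
        by_contra hne2
        apply h1
        rcases Z with _ | ⟨d, Z⟩
        · exact absurd rfl hne
        simp at hy
        subst hy
        simp
        ext1
        · exact hxy.symm
        · cases h1 : c.2 <;> cases h2 : d.2 <;> simp_all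
    have hWe : W = G ++ [c] ++ (Z ++ FreeGroup.invRev (G ++ [c])) := by
      have h2 := congrArg FreeGroup.toWord h
      rw [FreeGroup.inv_mk, FreeGroup.mul_mk, FreeGroup.mul_mk, List.append_assoc, FreeGroup.toWord_mk,
        FreeGroup.toWord_mk, hW.1.reduce_eq, hred.reduce_eq] at h2
      exact h2
    obtain ⟨g, hg⟩ : ∃ g, (G ++ [c]).head? = some g := by
      rcases G with _ | ⟨d, G⟩ <;> simp
    have k1 : W.head? = some g := by rw [hWe, List.head?_append, hg]; rfl
    have k2 : W.getLast? = some (g.1, !g.2) := by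
      rw [hWe, List.getLast?_append, List.getLast?_append]
      have : (FreeGroup.invRev (G ++ [c])).getLast? = (G ++ [c]).head?.map (fun c => (c.1, !c.2)) := by
        simp only [FreeGroup.invRev, List.getLast?_reverse, List.head?_map]
      rw [this, hg]; simp
    have := hW.2 _ k2 _ k1
    simp at this

/-- conjugate cyclically reduced elements have rotated words -/
lemma conj_rot {w g : F2} {Z : List Lt} (hw : CyclicallyReduced2 w) (hZ : CR Z)
    (h : w = g * FreeGroup.mk Z * g⁻¹) : w.toWord ~r Z := by
  by_cases hne : Z = []
  · have : FreeGroup.mk ([] : List Lt) = 1 := rfl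
    rw [hne, this] at h
    simp at h
    rw [h, hne]; simp
  refine rot_lemma g.toWord FreeGroup.isReduced_toWord Z w.toWord hZ hne ((cyc_iff w).1 hw) ?_
  simpa [FreeGroup.mk_toWord] using h

lemma CR_norm (w : F2) : CyclicallyReduced2 w ↔ (w * w).norm = 2 * w.norm := by
  rw [cyc_iff, CR_iff]
  unfold FreeGroup.norm
  rw [FreeGroup.toWord_mul]
  constructor
  · intro h; rw [h.reduce_eq]; simp; omega
  · intro h
    rw [FreeGroup.isReduced_iff_reduce_eq]
    have h1 := FreeGroup.reduce.red (L := w.toWord ++ w.toWord)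
    have h2 := h1.sublist
    exact h2.eq_of_length (by rw [h]; simp; omega)

lemma norm_Dx_le (t ε δ : Bool) (w : F2) : (Dx t ε δ w).norm ≤ w.norm := by
  have key : ∀ L : List Lt, (Dx t ε δ (FreeGroup.mk L)).norm ≤ L.length := by
    intro L
    induction L with
    | nil =>
      have : FreeGroup.mk ([] : List Lt) = 1 := rfl
      rw [this]; simp
    | cons c L ih =>
      have : FreeGroup.mk (c :: L) = FreeGroup.mk [c] * FreeGroup.mk L := by
        rw [FreeGroup.mul_mk]; rfl
      rw [this, map_mul]
      refine (FreeGroup.norm_mul_le _ _).trans ?_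
      have h1 : (Dx t ε δ (FreeGroup.mk [c])).norm ≤ 1 := by
        rcases c with ⟨i, b⟩
        have hb : FreeGroup.mk [(i, b)] = pw b (FreeGroup.of i) := by
          cases b
          · rw [pw_false, FreeGroup.of, FreeGroup.inv_mk]; rfl
          · rfl
        rw [hb]
        fin_cases i <;> cases b <;> cases t <;> cases ε <;> cases δ <;>
          simp [Dx, FreeGroup.norm_inv_eq]
      simp only [List.length_cons]
      omega
  have := key w.toWord
  rw [FreeGroup.mk_toWord] at this
  exact this

def DxI (t ε δ : Bool) : F2 →* F2 := if t then Dx t ε δ else Dx t δ ε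

lemma DxI_Dx (t ε δ : Bool) (w : F2) : DxI t ε δ (Dx t ε δ w) = w := by
  have : (DxI t ε δ).comp (Dx t ε δ) = MonoidHom.id F2 :=
    hom_ext2 (by cases t <;> cases ε <;> cases δ <;> simp [Dx, DxI])
     (by cases t <;> cases ε <;> cases δ <;> simp [Dx, DxI])
  exact DFunLike.congr_fun this w
lemma Dx_DxI (t ε δ : Bool) (w : F2) : Dx t ε δ (DxI t ε δ w) = w := by
  have : (Dx t ε δ).comp (DxI t ε δ) = MonoidHom.id F2 :=
    hom_ext2 (by cases t <;> cases ε <;> cases δ <;> simp [Dx, DxI])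
     (by cases t <;> cases ε <;> cases δ <;> simp [Dx, DxI])
  exact DFunLike.congr_fun this w

lemma norm_DxI (t ε δ : Bool) (w : F2) : (DxI t ε δ w).norm = w.norm := by
  apply le_antisymm
  · unfold DxI; split_ifs <;> exact norm_Dx_le _ _ _ _
  · have := norm_Dx_le t ε δ (DxI t ε δ w)
    rwa [Dx_DxI] at this

/-- cyclically reduced elements conjugate to an element of `Kbase` -/
def WW : Set F2 := {w | CyclicallyReduced2 w ∧ ∃ g z, Kbase z ∧ w = g * z * g⁻¹}

lemma PPc_WW {w : F2} (h : w ∈ PPc) : ∃ t ε δ s, ∃ v ∈ WW, w = Dx t ε δ (pw s v) ∧ v.norm = w.norm := by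
  obtain ⟨hc, hp⟩ := h
  obtain ⟨t, ε, δ, s, c, z, hz, e⟩ := PP_form hp
  refine ⟨t, ε, δ, s, pw s (DxI t ε δ w), ⟨?_, pw true (DxI t ε δ c), z, hz, ?_⟩, ?_, ?_⟩
  · rw [CR_norm] at hc ⊢
    have h1 : (DxI t ε δ w * DxI t ε δ w).norm = 2 * (DxI t ε δ w).norm := by
      rw [← map_mul, norm_DxI, norm_DxI, hc]
    cases s
    · simp only [pw_false]
      rw [← mul_inv_rev, FreeGroup.norm_inv_eq, FreeGroup.norm_inv_eq, h1]
    · simpa using h1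
  · rw [e, map_mul, map_mul, DxI_Dx]
    cases s <;> simp [mul_assoc]
  · cases s <;> simp [Dx_DxI]
  · cases s <;> simp [norm_DxI, FreeGroup.norm_inv_eq]

end

section
def blk (p : ℤ × Bool) : List Lt := List.replicate p.1.natAbs (0, decide (0 ≤ p.1)) ++ [(1, p.2)]

def flat (l : List (ℤ × Bool)) : List Lt := (l.map blk).flatten

@[simp] lemma flat_nil : flat [] = [] := rfl
@[simp] lemma flat_cons (p : ℤ × Bool) (l) : flat (p :: l) = blk p ++ flat l := by simp [flat]
@[simp] lemma flat_append (l l') : flat (l ++ l') = flat l ++ flat l' := by simp [flat]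

def LP (A : Bool → ℤ → Bool → Prop) : Bool → Bool → List (ℤ × Bool) → Prop
  | σ, τ, [] => σ = τ
  | σ, τ, p :: l => A σ p.1 p.2 ∧ LP A p.2 τ l

lemma LP_append {A : Bool → ℤ → Bool → Prop} (l l' : List (ℤ × Bool)) : ∀ σ τ : Bool,
    LP A σ τ (l ++ l') ↔ ∃ ρ, LP A σ ρ l ∧ LP A ρ τ l' := by
  induction l with
  | nil => intro σ τ; simp [LP]
  | cons p l ih => intro σ τ; simp [LP, ih, and_assoc]

lemma mk_rep (k : ℤ) : FreeGroup.mk (List.replicate k.natAbs ((0 : Fin 2), decide (0 ≤ k))) = ga ^ k := by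
  have h : ∀ (n : ℕ) (b : Bool), FreeGroup.mk (List.replicate n ((0 : Fin 2), b)) = (pw b ga) ^ n := by
    intro n b
    induction n with
    | zero => rfl
    | succ n ih =>
      rw [List.replicate_succ', ← FreeGroup.mul_mk, ih, pow_succ]
      congr 1
      cases b
      · rw [pw_false, ga, FreeGroup.of, FreeGroup.inv_mk]; rfl
      · rfl
  rw [h]
  by_cases hk : 0 ≤ k
  · obtain ⟨n, rfl⟩ := Int.eq_ofNat_of_zero_le hk
    simp
  · obtain ⟨n, rfl⟩ : ∃ n : ℕ, k = -n := ⟨k.natAbs, by omega⟩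
    simp only [hk, decide_false, pw_false]
    simp

lemma mk_blk (p : ℤ × Bool) : FreeGroup.mk (blk p) = ga ^ p.1 * pw p.2 gb := by
  rw [blk, ← FreeGroup.mul_mk, mk_rep]
  congr 1
  cases p.2
  · rw [pw_false, gb, FreeGroup.of, FreeGroup.inv_mk]; rfl
  · rfl

lemma Pa_LP {A : Bool → ℤ → Bool → Prop} {σ τ : Bool} {w : F2} (h : Pa A σ τ w) :
    ∃ l, LP A σ τ l ∧ w = FreeGroup.mk (flat l) := by
  induction h with
  | nil => exact ⟨[], rfl, rfl⟩
  | @snoc τ δ w k _ hA ih =>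
    obtain ⟨l, h1, rfl⟩ := ih
    refine ⟨l ++ [(k, δ)], (LP_append _ _ _ _).2 ⟨τ, h1, hA, rfl⟩, ?_⟩
    rw [flat_append, ← FreeGroup.mul_mk, flat_cons, flat_nil, List.append_nil, mk_blk, mul_assoc]

def NZ (A : Bool → ℤ → Bool → Prop) : Prop := ∀ σ k δ, A σ k δ → σ ≠ δ → k ≠ 0

lemma NZ_AD (l : ℕ) : NZ (AD l) := by
  intro σ k δ
  cases σ <;> cases δ <;> simp [AD] <;> omega

lemma NZ_Ainf : NZ Ainf := by
  intro σ k δ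
  cases σ <;> cases δ <;> simp [Ainf] <;> omega

lemma flat_red {A : Bool → ℤ → Bool → Prop} (hA : NZ A) (l : List (ℤ × Bool)) : ∀ σ τ, LP A σ τ l →
    FreeGroup.IsReduced (((1, σ) : Lt) :: flat l) := by
  induction l with
  | nil => intro σ τ _; simp [FreeGroup.IsReduced]
  | cons p l ih =>
    intro σ τ h
    obtain ⟨k, δ⟩ := p
    have h2 := ih _ _ h.2
    have h1 := hA _ _ _ h.1
    simp only [flat_cons, blk, List.append_assoc]
    unfold FreeGroup.IsReduced at *
    simp only [List.singleton_append]
    rw [← List.singleton_append, ← List.append_assoc, List.isChain_append]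
    refine ⟨?_, h2, ?_⟩
    · rw [List.isChain_append]
      refine ⟨by simp, ?_, ?_⟩
      · exact List.isChain_replicate_of_rel _ (by simp)
      · intro x hx y hy
        simp at hx
        subst hx
        rw [List.head?_replicate] at hy
        split_ifs at hy
        · simp at hy
        · simp at hy; subst hy; simp
    · intro x hx y hy
      simp only [List.head?_cons, Option.mem_def, Option.some.injEq] at hy
      subst hy
      by_cases hk : k = 0
      · subst hk
        simp at hx
        subst hx
        simp
        by_contra hne
        exact h1 hne rfl
      · rw [List.getLast?_append, List.getLast?_replicate] at hx
        simp [hk] at hx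
        subst hx
        simp

lemma flat_CR {A : Bool → ℤ → Bool → Prop} (hA : NZ A) {l : List (ℤ × Bool)} {σ : Bool}
    (h : LP A σ σ l) : CR (flat l) := by
  rw [CR_iff]
  have := flat_red hA (l ++ l) σ σ ((LP_append _ _ _ _).2 ⟨σ, h, h⟩)
  rw [flat_append] at this
  exact red_sub this ⟨[(1, σ)], [], by simp⟩

lemma cut (l : List (ℤ × Bool)) : ∀ u v : List Lt, v ≠ [] → flat l = u ++ v →
    ∃ l1 b l2 s t, l = l1 ++ b :: l2 ∧ blk b = s ++ t ∧ t ≠ [] ∧ u = flat l1 ++ s ∧ v = t ++ flat l2 := by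
  induction l with
  | nil => intro u v hv h; simp at h; exact absurd h.2 hv
  | cons p l ih =>
    intro u v hv h
    rw [flat_cons, List.append_eq_append_iff] at h
    have right : ∀ as, u = blk p ++ as → flat l = as ++ v → ∃ l1 b l2 s t, p :: l = l1 ++ b :: l2 ∧
        blk b = s ++ t ∧ t ≠ [] ∧ u = flat l1 ++ s ∧ v = t ++ flat l2 := by
      intro as h1 h2
      obtain ⟨l1, b, l2, s, t, e1, e2, e3, e4, e5⟩ := ih _ _ hv h2
      refine ⟨p :: l1, b, l2, s, t, by simp [e1], e2, e3, ?_, e5⟩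
      rw [h1, e4]; simp
    rcases h with ⟨as, h1, h2⟩ | ⟨bs, h1, h2⟩
    · exact right as h1 h2
    · by_cases hb : bs = []
      · subst hb
        simp at h1 h2
        exact right [] (by simp [h1]) (by simp [h2])
      · exact ⟨[], p, l, u, bs, by simp, h1, hb, by simp, h2⟩

def wd (k : ℤ) (j : ℕ) (δ : Bool) (l : List (ℤ × Bool)) : List Lt :=
  List.replicate j (0, decide (0 ≤ k)) ++ [(1, δ)] ++ flat l ++ List.replicate (k.natAbs - j) (0, decide (0 ≤ k))

def WA (A : Bool → ℤ → Bool → Prop) : Set F2 := {w | ∃ k j δ τ l, j ≤ k.natAbs ∧ A τ k δ ∧ LP A δ τ l ∧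
  w.toWord = wd k j δ l}

lemma blk_cut {k : ℤ} {δ : Bool} {s t : List Lt} (h : blk (k, δ) = s ++ t) (ht : t ≠ []) :
    ∃ j ≤ k.natAbs, t = List.replicate j (0, decide (0 ≤ k)) ++ [(1, δ)] ∧
      s = List.replicate (k.natAbs - j) (0, decide (0 ≤ k)) := by
  rcases t.eq_nil_or_concat with rfl | ⟨t, d, rfl⟩
  · exact absurd rfl ht
  rw [List.concat_eq_append] at *
  unfold blk at h
  rw [← List.append_assoc] at h
  have h1 := List.append_inj' h rfl
  obtain ⟨h2, h3⟩ := h1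
  have h4 := List.append_eq_replicate_iff.1 h2.symm
  refine ⟨t.length, by simp only at h4; omega, ?_, ?_⟩
  · rw [← h3]; congr 1; exact h4.2.2
  · have : k.natAbs - t.length = s.length := by simp only at h4; omega
    rw [this]; exact h4.2.1

lemma loop_WA {A : Bool → ℤ → Bool → Prop} (hA : NZ A) {σ : Bool} {w g z : F2}
    (hw : CyclicallyReduced2 w) (hz : Pa A σ σ z) (h : w = g * z * g⁻¹) : w = 1 ∨ w ∈ WA A := by
  obtain ⟨l, hl, rfl⟩ := Pa_LP hz
  have hr := (conj_rot hw (flat_CR hA hl) h).symm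
  by_cases hne : flat l = []
  · left
    rw [hne] at hr
    have := List.isRotated_nil_iff'.1 hr
    exact FreeGroup.toWord_eq_nil_iff.1 this.symm
  right
  obtain ⟨n, hn⟩ := hr
  rw [List.rotate_eq_drop_append_take_mod] at hn
  set m := n % (flat l).length
  have hm : m < (flat l).length := Nat.mod_lt _ (List.length_pos_iff.2 hne)
  obtain ⟨l1, ⟨k, δ⟩, l2, s, t, e1, e2, e3, e4, e5⟩ := cut l ((flat l).take m) ((flat l).drop m)
    (by simp; omega) (by simp)
  obtain ⟨j, hj, rfl, rfl⟩ := blk_cut e2 e3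
  rw [e1, LP_append] at hl
  obtain ⟨ρ, k1, k2, k3⟩ := hl
  refine ⟨k, j, δ, ρ, l2 ++ l1, hj, k2, (LP_append _ _ _ _).2 ⟨σ, k3, k1⟩, ?_⟩
  rw [← hn, e4, e5, wd]
  simp

def WMon (ε δ : Bool) : Set F2 := {w | ∀ c ∈ w.toWord, c = (0, ε) ∨ c = (1, δ)}
def Wb (l : ℕ) : Set F2 := {w | ∃ k j L, j ≤ k.natAbs ∧ k ≤ -(l : ℤ) ∧ LP (AD l) false false L ∧
  w.toWord = wd k j false L}
def Wc (l : ℕ) : Set F2 := {w | ∃ k j δ τ L1 k' L2, j ≤ k.natAbs ∧ LP (AD l) δ false L1 ∧ k' ≤ -(l : ℤ) ∧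
  LP (AD l) false τ L2 ∧ w.toWord = wd k j δ (L1 ++ (k', false) :: L2)}

lemma LP_split (l : ℕ) (L : List (ℤ × Bool)) : ∀ σ τ, LP (AD l) σ τ L → LP Ainf σ τ L ∨
    ∃ L1 k' L2, LP (AD l) σ false L1 ∧ k' ≤ -(l : ℤ) ∧ LP (AD l) false τ L2 ∧
      L = L1 ++ (k', false) :: L2 := by
  induction L with
  | nil => intro σ τ h; left; exact h
  | cons p L ih =>
    intro σ τ h
    obtain ⟨k, δ⟩ := p
    by_cases hmm : σ = false ∧ δ = false
    · obtain ⟨rfl, rfl⟩ := hmm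
      exact Or.inr ⟨[], k, L, rfl, h.1, h.2, rfl⟩
    · rcases ih _ _ h.2 with h2 | ⟨L1, k', L2, h2, h3, h4, rfl⟩
      · left
        refine ⟨?_, h2⟩
        have := h.1
        cases σ <;> cases δ <;> simp [AD, Ainf] at * <;> omega
      · exact Or.inr ⟨(k, δ) :: L1, k', L2, ⟨h.1, h2⟩, h3, h4, rfl⟩

lemma Mon_word {ε δ : Bool} {z : F2} (h : z ∈ Mon ε δ) : ∃ L : List Lt,
    (∀ c ∈ L, c = (0, ε) ∨ c = (1, δ)) ∧ z = FreeGroup.mk L := by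
  induction h using Submonoid.closure_induction_right with
  | one => exact ⟨[], by simp, rfl⟩
  | mul_right x hx y hy ih =>
    obtain ⟨L, h1, rfl⟩ := ih
    rcases hy with rfl | rfl
    · refine ⟨L ++ [(0, ε)], ?_, ?_⟩
      · intro c hc; simp at hc; rcases hc with hc | rfl
        · exact h1 _ hc
        · simp
      · rw [← FreeGroup.mul_mk]
        congr 1
        cases ε
        · rw [pw_false, ga, FreeGroup.of, FreeGroup.inv_mk]; rfl
        · rfl
    · refine ⟨L ++ [(1, δ)], ?_, ?_⟩
      · intro c hc; simp at hc; rcases hc with hc | rfl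
        · exact h1 _ hc
        · simp
      · rw [← FreeGroup.mul_mk]
        congr 1
        cases δ
        · rw [pw_false, gb, FreeGroup.of, FreeGroup.inv_mk]; rfl
        · rfl

lemma Mon_CR {ε δ : Bool} {L : List Lt} (h : ∀ c ∈ L, c = (0, ε) ∨ c = (1, δ)) : CR L := by
  rw [CR_iff]
  unfold FreeGroup.IsReduced
  apply List.Pairwise.isChain
  rw [List.pairwise_iff_forall_sublist]
  intro a b hab h1
  have ha : a ∈ L := by have := hab.subset (a := a) (by simp); simpa using this
  have hb : b ∈ L := by have := hab.subset (a := b) (by simp); simpa using this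
  rcases h _ ha with rfl | rfl <;> rcases h _ hb with rfl | rfl <;> simp at h1 ⊢

theorem WW_sub {w : F2} (h : w ∈ WW) : (∃ ε δ, w ∈ WMon ε δ) ∨ w ∈ WA Ainf ∨
    ∃ l : ℕ, 1 ≤ l ∧ (w ∈ Wb l ∨ w ∈ Wc l) := by
  obtain ⟨hw, g, z, hz, e⟩ := h
  have one : ∀ w : F2, w = 1 → ∃ ε δ, w ∈ WMon ε δ := by
    rintro w rfl
    exact ⟨true, true, by simp [WMon]⟩
  rcases hz with ⟨ε, δ, hz⟩ | ⟨l, hl, σ, hz⟩ | ⟨σ, hz⟩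
  · left
    obtain ⟨L, hL, rfl⟩ := Mon_word hz
    have := conj_rot hw (Mon_CR hL) e
    exact ⟨ε, δ, fun c hc => hL c (this.mem_iff.1 hc)⟩
  · rcases loop_WA (NZ_AD l) hw hz e with h | ⟨k, j, δ, τ, L, hj, hA, hL, hwd⟩
    · exact Or.inl (one w h)
    · right
      by_cases hmm : τ = false ∧ δ = false
      · obtain ⟨rfl, rfl⟩ := hmm
        exact Or.inr ⟨l, hl, Or.inl ⟨k, j, L, hj, hA, hL, hwd⟩⟩
      · rcases LP_split l L _ _ hL with h2 | ⟨L1, k', L2, h2, h3, h4, rfl⟩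
        · left
          refine ⟨k, j, δ, τ, L, hj, ?_, h2, hwd⟩
          cases τ <;> cases δ <;> simp [AD, Ainf] at * <;> omega
        · exact Or.inr ⟨l, hl, Or.inr ⟨k, j, δ, τ, L1, k', L2, hj, h2, h3, h4, hwd⟩⟩
  · rcases loop_WA NZ_Ainf hw hz e with h | h
    · exact Or.inl (one w h)
    · exact Or.inr (Or.inl h)

end

section
open scoped ENNReal

lemma tsum_cover {α ι : Type} (u : α → ℝ≥0∞) (wt : ι → ℝ≥0∞) (f : ι → α)
    (h : ∀ a, u a ≠ 0 → ∃ i, f i = a ∧ u a ≤ wt i) : ∑' a, u a ≤ ∑' i, wt i := by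
  choose g hg1 hg2 using h
  rw [← tsum_subtype_support u]
  have hinj : Function.Injective (fun a : Function.support u => g a.1 a.2) := by
    intro a b hab
    have : f (g a.1 a.2) = f (g b.1 b.2) := congrArg f hab
    rw [hg1 a.1 a.2, hg1 b.1 b.2] at this
    exact Subtype.ext this
  calc ∑' a : Function.support u, u a ≤ ∑' a : Function.support u, wt (g a.1 a.2) :=
        ENNReal.tsum_le_tsum fun a => hg2 _ _
    _ ≤ _ := ENNReal.tsum_comp_le_tsum_of_injective hinj wt

lemma tsum_list {α : Type} (f : List α → ℝ≥0∞) :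
    ∑' l, f l = f [] + ∑' p, ∑' l, f (p :: l) := by
  classical
  rw [ENNReal.tsum_eq_add_tsum_ite (f := f) []]
  congr 1
  rw [← ENNReal.tsum_prod]
  have hinj : Function.Injective (fun q : α × List α => q.1 :: q.2) := by
    rintro ⟨a, l⟩ ⟨b, m⟩ h; simpa using h
  rw [← hinj.tsum_eq]
  · simp
  · intro l hl
    rcases l with _ | ⟨a, l⟩
    · simp at hl
    · exact ⟨(a, l), rfl⟩

open Classical in
/-- edge weight -/
noncomputable def ew (A : Bool → ℤ → Bool → Prop) (X : ℝ≥0∞) (σ : Bool) (k : ℤ) (δ : Bool) : ℝ≥0∞ :=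
  if A σ k δ then X ^ (k.natAbs + 1) else 0

noncomputable def WL (A : Bool → ℤ → Bool → Prop) (X : ℝ≥0∞) : Bool → List (ℤ × Bool) → ℝ≥0∞
  | _, [] => 1
  | σ, p :: l => ew A X σ p.1 p.2 * WL A X p.2 l

lemma flat_len_cons (p : ℤ × Bool) (l) : (flat (p :: l)).length = p.1.natAbs + 1 + (flat l).length := by
  simp [blk]; try omega

lemma LP_WL {A : Bool → ℤ → Bool → Prop} (X : ℝ≥0∞) (l : List (ℤ × Bool)) : ∀ σ τ, LP A σ τ l →
    X ^ (flat l).length = WL A X σ l := by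
  induction l with
  | nil => intro σ τ _; simp [WL]
  | cons p l ih =>
    intro σ τ h
    rw [flat_len_cons, pow_add, ih _ _ h.2, WL, ew, if_pos h.1]

lemma path_sum (A : Bool → ℤ → Bool → Prop) (X : ℝ≥0∞) (h : Bool → ℝ≥0∞)
    (hs : ∀ σ, 1 + ∑ δ, (∑' k, ew A X σ k δ) * h δ ≤ h σ) (σ : Bool) : ∑' l, WL A X σ l ≤ h σ := by
  have key : ∀ (N : ℕ) σ, ∑' l : List (ℤ × Bool), (if l.length ≤ N then WL A X σ l else 0) ≤ h σ := by
    intro N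
    induction N with
    | zero =>
      intro σ
      rw [tsum_list]
      simp only [List.length_nil, le_refl, if_true, List.length_cons, nonpos_iff_eq_zero,
        Nat.add_eq_zero_iff, one_ne_zero, and_false, if_false, tsum_zero, add_zero, WL]
      exact le_trans le_self_add (hs σ)
    | succ N ih =>
      intro σ
      rw [tsum_list]
      refine le_trans ?_ (hs σ)
      simp only [List.length_nil, zero_le, if_true, WL, List.length_cons, add_le_add_iff_right]
      gcongr
      rw [ENNReal.tsum_prod', ENNReal.tsum_comm, tsum_fintype]
      gcongr with δ
      rw [← ENNReal.tsum_mul_right]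
      refine ENNReal.tsum_le_tsum fun k => ?_
      have : ∀ l : List (ℤ × Bool), (if l.length ≤ N then ew A X σ k δ * WL A X δ l else 0) =
          ew A X σ k δ * (if l.length ≤ N then WL A X δ l else 0) := by intro l; split_ifs <;> simp
      simp only [this]
      rw [ENNReal.tsum_mul_left]
      gcongr
      exact ih δ
  rw [ENNReal.tsum_eq_iSup_sum]
  refine iSup_le fun s => ?_
  refine le_trans ?_ (key (s.sup List.length) σ)
  refine le_trans ?_ (ENNReal.sum_le_tsum s)
  refine Finset.sum_le_sum fun l hl => ?_
  rw [if_pos (Finset.le_sup (f := List.length) hl)]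

noncomputable def GF (S : Set F2) (X : ℝ≥0∞) : ℝ≥0∞ := ∑' w : S, X ^ (w : F2).norm

lemma GF_cover {S : Set F2} {X : ℝ≥0∞} {ι : Type} (f : ι → F2) (wt : ι → ℝ≥0∞)
    (h : ∀ w ∈ S, ∃ i, f i = w ∧ X ^ w.norm ≤ wt i) : GF S X ≤ ∑' i, wt i := by
  unfold GF
  choose g hg1 hg2 using h
  have hinj : Function.Injective (fun a : S => g a.1 a.2) := by
    intro a b hab
    have := congrArg f hab
    simp only [hg1] at this
    exact Subtype.ext this
  calc ∑' a : S, X ^ (a : F2).norm ≤ ∑' a : S, wt (g a.1 a.2) :=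
        ENNReal.tsum_le_tsum fun a => hg2 _ _
    _ ≤ _ := ENNReal.tsum_comp_le_tsum_of_injective hinj wt

lemma geo_sum {x : ℝ} (h0 : 0 ≤ x) (h1 : x < 1) (m : ℕ) :
    ∑' n : ℕ, (ENNReal.ofReal x) ^ (n + m) = ENNReal.ofReal (x ^ m / (1 - x)) := by
  have : ∀ n : ℕ, (ENNReal.ofReal x) ^ (n + m) = ENNReal.ofReal (x ^ n * x ^ m) := by
    intro n; rw [← pow_add, ENNReal.ofReal_pow h0]
  simp only [this]
  rw [← ENNReal.ofReal_tsum_of_nonneg (fun n => by positivity)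
    ((summable_geometric_of_lt_one h0 h1).mul_right _), tsum_mul_right, tsum_geometric_of_lt_one h0 h1]
  congr 1
  field_simp

lemma sum_int (f : ℤ → ℝ≥0∞) : ∑' k, f k = ∑' n : ℕ, f n + ∑' n : ℕ, f (-(n + 1 : ℤ)) := by
  exact tsum_of_nat_of_neg_add_one ENNReal.summable ENNReal.summable

lemma sum_le_neg (f : ℕ → ℝ≥0∞) (l : ℕ) :
    ∑' k : ℤ, (if k ≤ -(l : ℤ) then f k.natAbs else 0) ≤ ∑' n : ℕ, f (n + l) := by
  apply tsum_cover _ _ (fun n : ℕ => -((n + l : ℕ) : ℤ))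
  intro k hk
  have hk' : k ≤ -(l : ℤ) := by by_contra h; simp [h] at hk
  refine ⟨k.natAbs - l, by omega, ?_⟩
  rw [if_pos hk']
  have : k.natAbs - l + l = k.natAbs := by omega
  rw [this]

end

section
open scoped ENNReal

lemma path_bound (A : Bool → ℤ → Bool → Prop) (X : ℝ≥0∞) (α β γ H : ℝ) (hα : 0 ≤ α) (hβ : 0 ≤ β)
    (hγ : 0 ≤ γ) (hα1 : α ≤ 1) (hβ1 : β ≤ 1) (hd : 0 < (1 - α) * (1 - β) - γ ^ 2)
    (h1 : ∑' k, ew A X true k true ≤ ENNReal.ofReal α)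
    (h2 : ∑' k, ew A X true k false ≤ ENNReal.ofReal γ)
    (h3 : ∑' k, ew A X false k true ≤ ENNReal.ofReal γ)
    (h4 : ∑' k, ew A X false k false ≤ ENNReal.ofReal β)
    (hH1 : (1 - β + γ) / ((1 - α) * (1 - β) - γ ^ 2) ≤ H)
    (hH2 : (1 - α + γ) / ((1 - α) * (1 - β) - γ ^ 2) ≤ H) (σ : Bool) :
    ∑' l, WL A X σ l ≤ ENNReal.ofReal H := by
  set D := (1 - α) * (1 - β) - γ ^ 2 with hD
  have p1 : 0 ≤ (1 - β + γ) / D := div_nonneg (by linarith) hd.le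
  have p2 : 0 ≤ (1 - α + γ) / D := div_nonneg (by linarith) hd.le
  refine le_trans (path_sum A X (fun σ => ENNReal.ofReal (if σ then (1 - β + γ) / D else (1 - α + γ) / D)) ?_ σ) ?_
  · intro σ
    simp only [Fintype.univ_bool, Finset.mem_singleton, Bool.true_eq_false, not_false_eq_true,
      Finset.sum_insert, Finset.sum_singleton, if_true, Bool.false_eq_true, if_false]
    rcases σ with _ | _
    · calc _ ≤ 1 + (ENNReal.ofReal γ * ENNReal.ofReal ((1 - β + γ) / D) + ENNReal.ofReal β * ENNReal.ofReal ((1 - α + γ) / D)) := by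
            gcongr
        _ = ENNReal.ofReal (1 + (γ * ((1 - β + γ) / D) + β * ((1 - α + γ) / D))) := by
          rw [ENNReal.ofReal_add (by norm_num) (by positivity), ENNReal.ofReal_add (by positivity) (by positivity),
            ENNReal.ofReal_mul hγ, ENNReal.ofReal_mul hβ, ENNReal.ofReal_one]
        _ ≤ _ := by
          apply ENNReal.ofReal_le_ofReal
          apply le_of_eq
          simp only [Bool.false_eq_true, if_false]
          rw [eq_div_iff hd.ne']
          have : D / D = 1 := div_self hd.ne'
          field_simp
          rw [hD]; ring
    · calc _ ≤ 1 + (ENNReal.ofReal α * ENNReal.ofReal ((1 - β + γ) / D) + ENNReal.ofReal γ * ENNReal.ofReal ((1 - α + γ) / D)) := by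
            gcongr
        _ = ENNReal.ofReal (1 + (α * ((1 - β + γ) / D) + γ * ((1 - α + γ) / D))) := by
          rw [ENNReal.ofReal_add (by norm_num) (by positivity), ENNReal.ofReal_add (by positivity) (by positivity),
            ENNReal.ofReal_mul hγ, ENNReal.ofReal_mul hα, ENNReal.ofReal_one]
        _ ≤ _ := by
          apply ENNReal.ofReal_le_ofReal
          apply le_of_eq
          simp only [if_true]
          rw [eq_div_iff hd.ne']
          field_simp
          rw [hD]; ring
  · apply ENNReal.ofReal_le_ofReal
    rcases σ with _ | _
    · simpa using hH2
    · simpa using hH1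

noncomputable def rho (x : ℝ) : ℝ := x * (1 + x) / (1 - x) + (x ^ 2 / (1 - x)) ^ 2

lemma neg_sum {x : ℝ} (h0 : 0 ≤ x) (h1 : x < 1) (l : ℕ) :
    ∑' k : ℤ, (if k ≤ -(l : ℤ) then ENNReal.ofReal x ^ (k.natAbs + 1) else 0) ≤ ENNReal.ofReal (x ^ (l + 1) / (1 - x)) := by
  refine (sum_le_neg (fun n => ENNReal.ofReal x ^ (n + 1)) l).trans ?_
  simp only [add_assoc]
  rw [geo_sum h0 h1]

lemma top_sum {x : ℝ} (h0 : 0 ≤ x) (h1 : x < 1) :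
    ∑' k : ℤ, ENNReal.ofReal x ^ (k.natAbs + 1) = ENNReal.ofReal (x * (1 + x) / (1 - x)) := by
  have : 0 < 1 - x := by linarith
  rw [sum_int]
  have e : ∀ n : ℕ, (-((n : ℤ) + 1)).natAbs + 1 = n + 2 := by intro n; omega
  simp only [e, Int.natAbs_natCast]
  rw [geo_sum h0 h1, geo_sum h0 h1, ← ENNReal.ofReal_add (by positivity) (by positivity)]
  congr 1; field_simp

lemma cut_sum {x : ℝ} (h0 : 0 ≤ x) (h1 : x < 1) (l : ℕ) :
    ∑' k : ℤ, (if k ≤ (l : ℤ) + 1 then ENNReal.ofReal x ^ (k.natAbs + 1) else 0) ≤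
      ENNReal.ofReal (x * (1 + x) / (1 - x) - x ^ (l + 3) / (1 - x)) := by
  have : 0 < 1 - x := by linarith
  rw [sum_int]
  have e : ∀ n : ℕ, (-((n : ℤ) + 1)).natAbs + 1 = n + 2 := by intro n; omega
  have e2 : ∀ n : ℕ, (-((n : ℤ) + 1)) ≤ (l : ℤ) + 1 := by intro n; omega
  simp only [e, e2, Int.natAbs_natCast, if_true]
  rw [geo_sum h0 h1]
  rw [tsum_eq_sum (s := Finset.range (l + 2)) (by
    intro n hn; simp at hn; rw [if_neg (by omega)])]
  have : ∑ b ∈ Finset.range (l + 2), (if (b : ℤ) ≤ (l : ℤ) + 1 then ENNReal.ofReal x ^ (b + 1) else 0)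
      = ENNReal.ofReal (∑ b ∈ Finset.range (l + 2), x ^ (b + 1)) := by
    rw [ENNReal.ofReal_sum_of_nonneg (fun i _ => by positivity)]
    refine Finset.sum_congr rfl fun b hb => ?_
    simp at hb
    rw [if_pos (by omega), ENNReal.ofReal_pow h0]
  rw [this, ← ENNReal.ofReal_add (Finset.sum_nonneg fun i _ => by positivity) (by positivity)]
  apply ENNReal.ofReal_le_ofReal
  have g : ∑ b ∈ Finset.range (l + 2), x ^ (b + 1) = x * (∑ b ∈ Finset.range (l + 2), x ^ b) := by
    rw [Finset.mul_sum]; refine Finset.sum_congr rfl fun b _ => by ring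
  rw [g, geom_sum_eq h1.ne]
  have : x - 1 ≠ 0 := by linarith
  have e : (x ^ (l + 2) - 1) / (x - 1) = (1 - x ^ (l + 2)) / (1 - x) := by
    rw [← neg_div_neg_eq]; ring_nf
  rw [e]
  apply le_of_eq
  field_simp
  ring

lemma ew_if {A : Bool → ℤ → Bool → Prop} {X : ℝ≥0∞} {σ δ : Bool} (P : ℤ → Prop) [DecidablePred P]
    (h : ∀ k, A σ k δ ↔ P k) : ∑' k, ew A X σ k δ = ∑' k, (if P k then X ^ (k.natAbs + 1) else 0) := by
  refine tsum_congr fun k => ?_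
  unfold ew
  by_cases hk : P k
  · rw [if_pos hk, if_pos ((h k).2 hk)]
  · rw [if_neg hk, if_neg (fun h' => hk ((h k).1 h'))]

lemma path_inf {x : ℝ} (h0 : 39 / 100 ≤ x) (h1 : x ≤ 2 / 5) (hr : rho x < 1) (σ : Bool) :
    ∑' l, WL Ainf (ENNReal.ofReal x) σ l ≤ ENNReal.ofReal (2 / (1 - rho x)) := by
  have hx0 : 0 ≤ x := by linarith
  have hx1 : x < 1 := by linarith
  have hx2 : 0 < 1 - x := by linarith
  have hA : x * (1 + x) / (1 - x) ≤ 1 := by rw [div_le_one hx2]; nlinarith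
  have hA0 : 0 ≤ x * (1 + x) / (1 - x) := by positivity
  have hg : x ^ 2 / (1 - x) ≤ 1 := by rw [div_le_one hx2]; nlinarith
  have hN := neg_sum hx0 hx1 1
  have hD : (1 - x * (1 + x) / (1 - x)) * (1 - 0) - (x ^ 2 / (1 - x)) ^ 2 = 1 - rho x := by
    unfold rho; ring
  have hd : 0 < 1 - rho x := by linarith
  refine path_bound _ _ (x * (1 + x) / (1 - x)) 0 (x ^ 2 / (1 - x)) _ (by positivity) le_rfl (by positivity) hA
    zero_le_one ?_ ?_ ?_ ?_ ?_ ?_ ?_ σ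
  · rw [hD]; exact hd
  · rw [ew_if (fun _ => True) (fun k => Iff.rfl)]; simp only [if_true]; rw [top_sum hx0 hx1]
  · rw [ew_if (fun k => k ≤ -1) (fun k => Iff.rfl)]; exact_mod_cast hN
  · rw [ew_if (fun k => k ≤ -1) (fun k => Iff.rfl)]; exact_mod_cast hN
  · simp [ew, Ainf]
  · rw [hD]; gcongr; linarith
  · rw [hD]; gcongr; linarith

lemma path_l {x : ℝ} (h0 : 39 / 100 ≤ x) (h1 : x ≤ 2 / 5) (hr : rho x < 1) (l : ℕ) (hl : 1 ≤ l) (σ : Bool) :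
    ∑' L, WL (AD l) (ENNReal.ofReal x) σ L ≤ ENNReal.ofReal (100 / (1 - rho x + x ^ l)) := by
  have hx0 : 0 < x := by linarith
  have hx1 : x < 1 := by linarith
  have hx2 : 0 < 1 - x := by linarith
  have hN := neg_sum hx0.le hx1 1
  have hd : 0 < 1 - rho x := by linarith
  have hA : x * (1 + x) / (1 - x) ≤ 1 := by rw [div_le_one hx2]; nlinarith
  have hA8 : 8 / 10 ≤ x * (1 + x) / (1 - x) := by rw [le_div_iff₀ hx2]; nlinarith
  have hg : x ^ 2 / (1 - x) ≤ 267 / 1000 := by rw [div_le_iff₀ hx2]; nlinarith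
  have hg0 : 0 ≤ x ^ 2 / (1 - x) := by positivity
  have hl0 : 0 < x ^ l := by positivity
  have hlx : x ^ l ≤ x := by
    calc x ^ l ≤ x ^ 1 := pow_le_pow_of_le_one hx0.le hx1.le hl
      _ = x := pow_one x
  set y := x ^ l with hy
  set c := (1 - x)⁻¹ with hc
  have hc1 : 1 ≤ c := by rw [hc]; exact (one_le_inv₀ hx2).2 (by linarith)
  have hc0 : (1 - x) * c = 1 := mul_inv_cancel₀ hx2.ne'
  have eβ : x ^ (l + 1) / (1 - x) = y * x * c := by rw [pow_succ, div_eq_mul_inv]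
  have eα : x ^ (l + 3) / (1 - x) = y * x ^ 3 * c := by rw [pow_add, div_eq_mul_inv]
  have eγ : x ^ 2 / (1 - x) = x ^ 2 * c := by rw [div_eq_mul_inv]
  have hβg : x ^ (l + 1) / (1 - x) ≤ x ^ 2 / (1 - x) := by
    gcongr ?_ / _
    exact pow_le_pow_of_le_one hx0.le hx1.le (by omega)
  have hβ0 : 0 ≤ x ^ (l + 1) / (1 - x) := by positivity
  have hα0 : 0 ≤ x ^ (l + 3) / (1 - x) := by positivity
  have hαg : x ^ (l + 3) / (1 - x) ≤ x ^ 2 / (1 - x) := by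
    gcongr ?_ / _
    exact pow_le_pow_of_le_one hx0.le hx1.le (by omega)
  set A := x * (1 + x) / (1 - x) with hAd
  set a := x ^ (l + 3) / (1 - x) with ha
  set b := x ^ (l + 1) / (1 - x) with hb
  set g := x ^ 2 / (1 - x) with hgd
  have hab : a = x ^ 2 * b := by rw [eα, eβ]; ring
  have hrho : 1 - rho x = 1 - A - g ^ 2 := by unfold rho; ring
  have hby : 6 / 10 * y ≤ b := by
    rw [hb, pow_succ, ← hy, le_div_iff₀ hx2]; nlinarith
  have hg2 : g ^ 2 ≤ 0.0713 := by nlinarith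
  have hxx : 0.152 ≤ x ^ 2 := by nlinarith
  have hdet : 2 / 100 * (1 - rho x + y) ≤ (1 - (A - a)) * (1 - b) - g ^ 2 := by
    have : (1 - (A - a)) * (1 - b) - g ^ 2 = (1 - rho x) * (1 - b) + b * (x ^ 2 * (1 - b) - g ^ 2) := by
      rw [hrho, hab]; ring
    rw [this]
    have t1 : 0.04 ≤ x ^ 2 * (1 - b) - g ^ 2 := by nlinarith
    have t2 : b * 0.04 ≤ b * (x ^ 2 * (1 - b) - g ^ 2) := by gcongr
    have t3 : (1 - rho x) * 0.5 ≤ (1 - rho x) * (1 - b) := by gcongr; linarith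
    linarith
  have hdp : 0 < 2 / 100 * (1 - rho x + y) := by positivity
  have hfin : ∀ z : ℝ, z ≤ 2 → z / ((1 - (A - a)) * (1 - b) - g ^ 2) ≤ 100 / (1 - rho x + y) := by
    intro z hz
    rw [div_le_div_iff₀ (by linarith) (by positivity)]
    nlinarith
  refine path_bound _ _ (A - a) b g _ (by linarith) hβ0 hg0 (by linarith)
    (by linarith) (by linarith) ?_ ?_ ?_ ?_ (hfin _ (by linarith)) (hfin _ (by linarith)) σ
  · rw [ew_if (fun k => k ≤ (l : ℤ) + 1) (fun k => Iff.rfl)]; exact cut_sum hx0.le hx1 l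
  · rw [ew_if (fun k => k ≤ -1) (fun k => Iff.rfl)]; exact_mod_cast hN
  · rw [ew_if (fun k => k ≤ -1) (fun k => Iff.rfl)]; exact_mod_cast hN
  · rw [ew_if (fun k => k ≤ -(l : ℤ)) (fun k => Iff.rfl)]; exact neg_sum hx0.le hx1 l

end

section
open scoped ENNReal

lemma tsum_mul_prod {α β : Type} (f : α → ℝ≥0∞) (g : β → ℝ≥0∞) :
    ∑' p : α × β, f p.1 * g p.2 = (∑' a, f a) * ∑' b, g b := by
  rw [ENNReal.tsum_prod (f := fun a b => f a * g b)]
  simp only [ENNReal.tsum_mul_left, ENNReal.tsum_mul_right]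

lemma half_bound {x : ℝ} (h0 : 0 ≤ x) (h1 : x ≤ 2 / 5) (n : ℕ) : ((n : ℝ) + 1) * x ^ (n + 1) ≤ (1 / 2) ^ n := by
  have : ((n : ℝ) + 1) * x ^ (n + 1) ≤ ((n : ℝ) + 1) * (2 / 5) ^ (n + 1) := by gcongr
  refine this.trans ?_
  clear this
  by_cases hn : n < 3
  · interval_cases n <;> norm_num
  · push Not at hn
    induction n, hn using Nat.le_induction with
    | base => norm_num
    | succ n hn ih =>
      have h3 : (3 : ℝ) ≤ n := by exact_mod_cast hn
      have p : (0 : ℝ) < (2 / 5) ^ (n + 1) := by positivity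
      rw [pow_succ (2 / 5 : ℝ) (n + 1), pow_succ (1 / 2 : ℝ) n]
      push_cast
      nlinarith

noncomputable def rwt (X : ℝ≥0∞) (p : ℤ × ℕ) : ℝ≥0∞ := if p.2 ≤ p.1.natAbs then X ^ (p.1.natAbs + 1) else 0

lemma rwt_sum {x : ℝ} (h0 : 0 ≤ x) (h1 : x ≤ 2 / 5) (k : ℤ) :
    ∑' j : ℕ, rwt (ENNReal.ofReal x) (k, j) ≤ ENNReal.ofReal (1 / 2) ^ k.natAbs := by
  rw [tsum_eq_sum (s := Finset.range (k.natAbs + 1)) (by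
    intro j hj; simp at hj; unfold rwt; rw [if_neg (by simp only; omega)])]
  have : ∀ j ∈ Finset.range (k.natAbs + 1), rwt (ENNReal.ofReal x) (k, j) = ENNReal.ofReal (x ^ (k.natAbs + 1)) := by
    intro j hj; simp at hj; unfold rwt; rw [if_pos (by simp only; omega), ENNReal.ofReal_pow h0]
  rw [Finset.sum_congr rfl this, Finset.sum_const, Finset.card_range, nsmul_eq_mul,
    ← ENNReal.ofReal_pow (by norm_num), ← ENNReal.ofReal_natCast, ← ENNReal.ofReal_mul (by positivity)]
  apply ENNReal.ofReal_le_ofReal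
  have := half_bound h0 h1 k.natAbs
  push_cast
  exact this

lemma rwt_neg {x : ℝ} (h0 : 0 ≤ x) (h1 : x ≤ 2 / 5) (l : ℕ) :
    ∑' p : ℤ × ℕ, (if p.1 ≤ -(l : ℤ) then rwt (ENNReal.ofReal x) p else 0) ≤ ENNReal.ofReal (2 * (1 / 2) ^ l) := by
  rw [ENNReal.tsum_prod']
  have : ∀ k : ℤ, ∑' j : ℕ, (if k ≤ -(l : ℤ) then rwt (ENNReal.ofReal x) (k, j) else 0) ≤
      (if k ≤ -(l : ℤ) then ENNReal.ofReal (1 / 2) ^ k.natAbs else 0) := by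
    intro k
    split_ifs
    · exact rwt_sum h0 h1 k
    · simp
  refine (ENNReal.tsum_le_tsum this).trans ?_
  refine (sum_le_neg (fun n => ENNReal.ofReal (1 / 2) ^ n) l).trans ?_
  rw [geo_sum (by norm_num) (by norm_num)]
  apply ENNReal.ofReal_le_ofReal
  apply le_of_eq; ring

lemma rwt_tot {x : ℝ} (h0 : 0 ≤ x) (h1 : x ≤ 2 / 5) :
    ∑' p : ℤ × ℕ, rwt (ENNReal.ofReal x) p ≤ ENNReal.ofReal 4 := by
  rw [ENNReal.tsum_prod']
  refine (ENNReal.tsum_le_tsum (rwt_sum h0 h1)).trans ?_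
  rw [sum_int]
  have e : ∀ n : ℕ, (-((n : ℤ) + 1)).natAbs = n + 1 := by intro n; omega
  have e2 : ∀ n : ℕ, (n : ℤ).natAbs = n + 0 := by intro n; simp
  simp only [e, e2]
  rw [geo_sum (by norm_num) (by norm_num), geo_sum (by norm_num) (by norm_num),
    ← ENNReal.ofReal_add (by norm_num) (by norm_num)]
  apply ENNReal.ofReal_le_ofReal
  norm_num

lemma wd_length {k : ℤ} {j : ℕ} (h : j ≤ k.natAbs) (δ : Bool) (l) :
    (wd k j δ l).length = (k.natAbs + 1) + (flat l).length := by
  simp [wd]; omega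

lemma norm_wd {w : F2} {k : ℤ} {j : ℕ} (h : j ≤ k.natAbs) (δ : Bool) (l) (e : w.toWord = wd k j δ l) :
    w.norm = (k.natAbs + 1) + (flat l).length := by
  rw [← wd_length h δ l, ← e]; rfl

lemma GF_WA {x : ℝ} (h0 : 39 / 100 ≤ x) (h1 : x ≤ 2 / 5) (hr : rho x < 1) :
    GF (WA Ainf) (ENNReal.ofReal x) ≤ ENNReal.ofReal (16 / (1 - rho x)) := by
  have hd : 0 < 1 - rho x := by linarith
  set X := ENNReal.ofReal x
  calc GF (WA Ainf) X ≤ ∑' i : (ℤ × ℕ) × (Bool × List (ℤ × Bool)), rwt X i.1 * WL Ainf X i.2.1 i.2.2 := by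
        apply GF_cover (fun i => FreeGroup.mk (wd i.1.1 i.1.2 i.2.1 i.2.2))
        rintro w ⟨k, j, δ, τ, l, hj, hA, hL, e⟩
        refine ⟨⟨⟨k, j⟩, ⟨δ, l⟩⟩, ?_, ?_⟩
        · simp only; rw [← e, FreeGroup.mk_toWord]
        · simp only [rwt]
          rw [norm_wd hj δ l e, if_pos hj, pow_add, LP_WL X l _ _ hL]
    _ ≤ ENNReal.ofReal 4 * (ENNReal.ofReal (2 / (1 - rho x)) + ENNReal.ofReal (2 / (1 - rho x))) := by
        rw [tsum_mul_prod (rwt X) (fun i : Bool × List (ℤ × Bool) => WL Ainf X i.1 i.2)]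
        gcongr
        · exact rwt_tot (by linarith) h1
        · rw [ENNReal.tsum_prod (f := fun δ l => WL Ainf X δ l), tsum_bool]
          gcongr <;> exact path_inf h0 h1 hr _
    _ ≤ _ := by
        rw [← ENNReal.ofReal_add (by positivity) (by positivity), ← ENNReal.ofReal_mul (by norm_num)]
        apply ENNReal.ofReal_le_ofReal
        apply le_of_eq; ring

lemma GF_Wb {x : ℝ} (h0 : 39 / 100 ≤ x) (h1 : x ≤ 2 / 5) (hr : rho x < 1) (l : ℕ) (hl : 1 ≤ l) :
    GF (Wb l) (ENNReal.ofReal x) ≤ ENNReal.ofReal (200 / (1 - rho x) * (1 / 2) ^ l) := by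
  have hd : 0 < 1 - rho x := by linarith
  have hx : 0 ≤ x := by linarith
  set X := ENNReal.ofReal x
  calc GF (Wb l) X ≤ ∑' i : (ℤ × ℕ) × List (ℤ × Bool), (if i.1.1 ≤ -(l : ℤ) then rwt X i.1 else 0) * WL (AD l) X false i.2 := by
        apply GF_cover (fun i => FreeGroup.mk (wd i.1.1 i.1.2 false i.2))
        rintro w ⟨k, j, L, hj, hk, hL, e⟩
        refine ⟨⟨⟨k, j⟩, L⟩, ?_, ?_⟩
        · simp only; rw [← e, FreeGroup.mk_toWord]
        · simp only [rwt]
          rw [norm_wd hj _ L e, if_pos hk, if_pos hj, pow_add, LP_WL X L _ _ hL]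
    _ ≤ ENNReal.ofReal (2 * (1 / 2) ^ l) * ENNReal.ofReal (100 / (1 - rho x)) := by
        rw [tsum_mul_prod (fun p : ℤ × ℕ => if p.1 ≤ -(l : ℤ) then rwt X p else 0) (fun i => WL (AD l) X false i)]
        gcongr
        · exact rwt_neg hx h1 l
        · refine (path_l h0 h1 hr l hl _).trans (ENNReal.ofReal_le_ofReal ?_)
          gcongr
          have : 0 ≤ x ^ l := by positivity
          linarith
    _ ≤ _ := by
        rw [← ENNReal.ofReal_mul (by positivity)]
        apply ENNReal.ofReal_le_ofReal
        apply le_of_eq; ring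

lemma GF_Wc {x : ℝ} (h0 : 39 / 100 ≤ x) (h1 : x ≤ 2 / 5) (hr : rho x < 1) (l : ℕ) (hl : 1 ≤ l) :
    GF (Wc l) (ENNReal.ofReal x) ≤ ENNReal.ofReal (80000 * (x ^ l / (1 - rho x + x ^ l) ^ 2)) := by
  have hd : 0 < 1 - rho x := by linarith
  have hx : 0 ≤ x := by linarith
  have hx1 : 0 < 1 - x := by linarith
  have hxl : 0 ≤ x ^ l := by positivity
  set X := ENNReal.ofReal x
  set H := ENNReal.ofReal (100 / (1 - rho x + x ^ l)) with hH
  calc GF (Wc l) X ≤ ∑' i : (ℤ × ℕ) × ((Bool × List (ℤ × Bool)) × (ℤ × List (ℤ × Bool))), rwt X i.1 *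
          (WL (AD l) X i.2.1.1 i.2.1.2 * ((if i.2.2.1 ≤ -(l : ℤ) then X ^ (i.2.2.1.natAbs + 1) else 0) *
            WL (AD l) X false i.2.2.2)) := by
        apply GF_cover (fun i => FreeGroup.mk (wd i.1.1 i.1.2 i.2.1.1 (i.2.1.2 ++ (i.2.2.1, false) :: i.2.2.2)))
        rintro w ⟨k, j, δ, τ, L1, k', L2, hj, hL1, hk', hL2, e⟩
        refine ⟨⟨⟨k, j⟩, ⟨δ, L1⟩, ⟨k', L2⟩⟩, ?_, ?_⟩
        · simp only; rw [← e, FreeGroup.mk_toWord]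
        · simp only [rwt]
          rw [norm_wd hj _ _ e, if_pos hk', if_pos hj, flat_append, List.length_append, flat_len_cons,
            pow_add, pow_add X (flat L1).length, pow_add X _ (flat L2).length, LP_WL X L1 _ _ hL1, LP_WL X L2 _ _ hL2]
    _ ≤ ENNReal.ofReal 4 * ((H + H) * (ENNReal.ofReal (x ^ (l + 1) / (1 - x)) * H)) := by
        rw [tsum_mul_prod (rwt X) (fun i : ((Bool × List (ℤ × Bool)) × (ℤ × List (ℤ × Bool))) => 
           (WL (AD l) X i.1.1 i.1.2 * ((if i.2.1 ≤ -(l : ℤ) then X ^ (i.2.1.natAbs + 1) else 0) *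
            WL (AD l) X false i.2.2))),
          tsum_mul_prod (fun i : (Bool × List (ℤ × Bool)) => WL (AD l) X i.1 i.2) (fun i : (ℤ × List (ℤ × Bool)) =>
            ((if i.1 ≤ -(l : ℤ) then X ^ (i.1.natAbs + 1) else 0) *
            WL (AD l) X false i.2)), tsum_mul_prod (fun k : ℤ => if k ≤ -(l : ℤ) then X ^ (k.natAbs + 1) else 0)
            (fun i => WL (AD l) X false i)]
        gcongr
        · exact rwt_tot hx h1
        · rw [ENNReal.tsum_prod (f := fun δ L => WL (AD l) X δ L), tsum_bool]
          gcongr <;> exact path_l h0 h1 hr l hl _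
        · exact neg_sum hx (by linarith) l
        · exact path_l h0 h1 hr l hl _
    _ ≤ _ := by
        rw [hH, ← ENNReal.ofReal_add (by positivity) (by positivity), ← ENNReal.ofReal_mul (by positivity),
          ← ENNReal.ofReal_mul (by positivity), ← ENNReal.ofReal_mul (by positivity)]
        apply ENNReal.ofReal_le_ofReal
        have : x ^ (l + 1) / (1 - x) ≤ x ^ l := by
          rw [div_le_iff₀ hx1, pow_succ]; gcongr; linarith
        calc _ ≤ 4 * ((100 / (1 - rho x + x ^ l) + 100 / (1 - rho x + x ^ l)) * (x ^ l * (100 / (1 - rho x + x ^ l)))) := by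
              gcongr
          _ = _ := by field_simp; ring

lemma tele {x δ : ℝ} (h0 : 0 < x) (h1 : x ≤ 2 / 5) (hd : 0 < δ) :
    ∑' l : ℕ, ENNReal.ofReal (x ^ l / (δ + x ^ l) ^ 2) ≤ ENNReal.ofReal (2 / δ) := by
  apply ENNReal.tsum_le_of_sum_range_le
  intro n
  rw [← ENNReal.ofReal_sum_of_nonneg (fun i _ => by positivity)]
  apply ENNReal.ofReal_le_ofReal
  have key : ∀ l : ℕ, x ^ l / (δ + x ^ l) ^ 2 ≤ 2 * (1 / (δ + x ^ (l + 1)) - 1 / (δ + x ^ l)) := by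
    intro l
    have p : 0 < x ^ l := by positivity
    rw [pow_succ x l]
    set y := x ^ l
    have e : 2 * (1 / (δ + y * x) - 1 / (δ + y)) = 2 * (y * (1 - x)) / ((δ + y * x) * (δ + y)) := by
      field_simp; ring
    rw [e, div_le_div_iff₀ (by positivity) (by positivity)]
    have h2 : δ + y * x ≤ δ + y := by nlinarith
    calc y * ((δ + y * x) * (δ + y)) ≤ y * ((δ + y) * (δ + y)) := by gcongr
      _ ≤ 2 * (y * (1 - x)) * (δ + y) ^ 2 := by
        have : y ≤ 2 * (y * (1 - x)) := by nlinarith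
        calc y * ((δ + y) * (δ + y)) = y * (δ + y) ^ 2 := by ring
          _ ≤ _ := by gcongr
  have : ∀ n : ℕ, ∑ l ∈ Finset.range n, x ^ l / (δ + x ^ l) ^ 2 ≤ 2 * (1 / (δ + x ^ n)) := by
    intro n
    induction n with
    | zero => simp; positivity
    | succ n ih => rw [Finset.sum_range_succ]; linarith [key n]
  refine (this n).trans ?_
  rw [mul_one_div]
  have : 0 ≤ x ^ n := by positivity
  gcongr; linarith

lemma sum_listBool (X : ℝ≥0∞) : ∑' l : List Bool, X ^ l.length = ∑' n : ℕ, (2 * X) ^ n := by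
  rw [← (Equiv.sigmaFiberEquiv (List.length : List Bool → ℕ)).tsum_eq, ENNReal.tsum_sigma']
  refine tsum_congr fun n => ?_
  have : ∀ b : {l : List Bool // l.length = n}, X ^ ((Equiv.sigmaFiberEquiv (List.length : List Bool → ℕ)) ⟨n, b⟩).length = X ^ n := by
    rintro ⟨b, rfl⟩; rfl
  simp only [this]
  let _ : Fintype {l : List Bool // l.length = n} := inferInstanceAs (Fintype (List.Vector Bool n))
  have hc : Fintype.card {l : List Bool // l.length = n} = 2 ^ n := (card_vector (α := Bool) n).trans (by simp)
  rw [tsum_fintype, Finset.sum_const, Finset.card_univ, nsmul_eq_mul, hc, mul_pow]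
  push_cast
  rfl

lemma GF_WMon {x : ℝ} (h0 : 39 / 100 ≤ x) (h1 : x ≤ 2 / 5) (ε δ : Bool) :
    GF (WMon ε δ) (ENNReal.ofReal x) ≤ ENNReal.ofReal 5 := by
  calc _ ≤ ∑' l : List Bool, (ENNReal.ofReal x) ^ l.length := by
        apply GF_cover (fun l : List Bool => FreeGroup.mk (l.map (fun c => if c then ((0 : Fin 2), ε) else (1, δ))))
        intro w hw
        refine ⟨w.toWord.map (fun c => decide (c.1 = 0)), ?_, ?_⟩
        · simp only [List.map_map]
          conv_rhs => rw [← FreeGroup.mk_toWord (x := w)]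
          congr 1
          conv_rhs => rw [← List.map_id w.toWord]
          refine List.map_congr_left fun c hc => ?_
          rcases hw c hc with rfl | rfl <;> simp
        · rw [List.length_map]; rfl
    _ ≤ _ := by
      rw [sum_listBool]
      have : (2 : ℝ≥0∞) * ENNReal.ofReal x = ENNReal.ofReal (2 * x) := by
        rw [ENNReal.ofReal_mul (by norm_num)]; simp
      have g := geo_sum (x := 2 * x) (by linarith) (by linarith) 0
      simp only [add_zero] at g
      rw [this, g]
      apply ENNReal.ofReal_le_ofReal
      rw [div_le_iff₀ (by linarith)]
      linarith

lemma GF_mono {S T : Set F2} (h : S ⊆ T) (X : ℝ≥0∞) : GF S X ≤ GF T X :=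
  ENNReal.tsum_mono_subtype (fun w : F2 => X ^ w.norm) h

lemma GF_union (S T : Set F2) (X : ℝ≥0∞) : GF (S ∪ T) X ≤ GF S X + GF T X :=
  ENNReal.tsum_union_le (fun w : F2 => X ^ w.norm) S T

lemma GF_iUnion (S : ℕ → Set F2) (X : ℝ≥0∞) : GF (⋃ i, S i) X ≤ ∑' i, GF (S i) X :=
  ENNReal.tsum_iUnion_le_tsum (fun w : F2 => X ^ w.norm) S

lemma GF_WW {x : ℝ} (h0 : 39 / 100 ≤ x) (h1 : x ≤ 2 / 5) (hr : rho x < 1) :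
    GF WW (ENNReal.ofReal x) ≤ ENNReal.ofReal (170000 / (1 - rho x)) := by
  have hd : 0 < 1 - rho x := by linarith
  have hx0 : 0 < x := by linarith
  have hx1 : 0 < 1 - x := by linarith
  have hd1 : 1 - rho x ≤ 1 := by
    have : 0 ≤ rho x := by unfold rho; positivity
    linarith
  set X := ENNReal.ofReal x
  have sub : WW ⊆ (((WMon true true ∪ WMon true false) ∪ (WMon false true ∪ WMon false false)) ∪ WA Ainf) ∪
      ((⋃ l : ℕ, Wb (l + 1)) ∪ (⋃ l : ℕ, Wc (l + 1))) := by
    intro w hw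
    rcases WW_sub hw with ⟨ε, δ, h⟩ | h | ⟨l, hl, h⟩
    · left; left
      rcases ε with _ | _ <;> rcases δ with _ | _ <;> simp [h]
    · left; right; exact h
    · obtain ⟨l, rfl⟩ : ∃ m, l = m + 1 := ⟨l - 1, by omega⟩
      right
      rcases h with h | h
      · left; exact Set.mem_iUnion.2 ⟨l, h⟩
      · right; exact Set.mem_iUnion.2 ⟨l, h⟩
  have hm := GF_WMon h0 h1
  have hb : ∑' l : ℕ, GF (Wb (l + 1)) X ≤ ENNReal.ofReal (200 / (1 - rho x)) := by
    refine (ENNReal.tsum_le_tsum fun l => GF_Wb h0 h1 hr (l + 1) (by omega)).trans ?_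
    simp only [ENNReal.ofReal_mul (show 0 ≤ 200 / (1 - rho x) by positivity)]
    rw [ENNReal.tsum_mul_left]
    have : ∑' l : ℕ, ENNReal.ofReal ((1 / 2) ^ (l + 1)) = 1 := by
      have g := geo_sum (x := 1 / 2) (by norm_num) (by norm_num) 1
      simp only [← ENNReal.ofReal_pow (show (0 : ℝ) ≤ 1 / 2 by norm_num)] at g
      rw [g]; norm_num
    rw [this, mul_one]
  have hc : ∑' l : ℕ, GF (Wc (l + 1)) X ≤ ENNReal.ofReal (160000 / (1 - rho x)) := by
    refine (ENNReal.tsum_le_tsum fun l => GF_Wc h0 h1 hr (l + 1) (by omega)).trans ?_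
    simp only [ENNReal.ofReal_mul (show (0 : ℝ) ≤ 80000 by norm_num)]
    rw [ENNReal.tsum_mul_left]
    have t := tele (δ := 1 - rho x) hx0 h1 hd
    have t2 : ∑' l : ℕ, ENNReal.ofReal (x ^ (l + 1) / (1 - rho x + x ^ (l + 1)) ^ 2) ≤ ENNReal.ofReal (2 / (1 - rho x)) :=
      (ENNReal.tsum_comp_le_tsum_of_injective (add_left_injective 1)
        (fun l : ℕ => ENNReal.ofReal (x ^ l / (1 - rho x + x ^ l) ^ 2))).trans t
    calc _ ≤ ENNReal.ofReal 80000 * ENNReal.ofReal (2 / (1 - rho x)) := by gcongr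
      _ = _ := by rw [← ENNReal.ofReal_mul (by norm_num)]; congr 1; ring
  calc GF WW X ≤ _ := GF_mono sub X
    _ ≤ (((GF (WMon true true) X + GF (WMon true false) X) + (GF (WMon false true) X + GF (WMon false false) X)) +
        GF (WA Ainf) X) + (GF (⋃ l : ℕ, Wb (l + 1)) X + GF (⋃ l : ℕ, Wc (l + 1)) X) := by
      refine (GF_union _ _ _).trans (add_le_add ((GF_union _ _ _).trans (add_le_add ((GF_union _ _ _).trans
        (add_le_add (GF_union _ _ _) (GF_union _ _ _))) le_rfl)) (GF_union _ _ _))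
    _ ≤ (((ENNReal.ofReal 5 + ENNReal.ofReal 5) + (ENNReal.ofReal 5 + ENNReal.ofReal 5)) +
        ENNReal.ofReal (16 / (1 - rho x))) + (ENNReal.ofReal (200 / (1 - rho x)) + ENNReal.ofReal (160000 / (1 - rho x))) := by
      refine add_le_add (add_le_add (add_le_add (add_le_add (hm _ _) (hm _ _)) (add_le_add (hm _ _) (hm _ _)))
        (GF_WA h0 h1 hr)) (add_le_add ((GF_iUnion _ _).trans hb) ((GF_iUnion _ _).trans hc))
    _ = ENNReal.ofReal (20 + 160216 / (1 - rho x)) := by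
      have p1 : 0 ≤ 16 / (1 - rho x) := by positivity
      have p2 : 0 ≤ 200 / (1 - rho x) := by positivity
      have p3 : 0 ≤ 160000 / (1 - rho x) := by positivity
      rw [← ENNReal.ofReal_add (by norm_num) (by norm_num), ← ENNReal.ofReal_add (by norm_num) (by norm_num),
        ← ENNReal.ofReal_add (by norm_num) p1, ← ENNReal.ofReal_add p2 p3,
        ← ENNReal.ofReal_add (by positivity) (by positivity)]
      congr 1; ring
    _ ≤ _ := by
      apply ENNReal.ofReal_le_ofReal
      have : 20 ≤ 20 / (1 - rho x) := by rw [le_div_iff₀ hd]; linarith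
      have e : (170000 : ℝ) / (1 - rho x) = 20 / (1 - rho x) + 160216 / (1 - rho x) + 9764 / (1 - rho x) := by ring
      have : 0 ≤ 9764 / (1 - rho x) := by positivity
      linarith

lemma GF_PPc {x : ℝ} (h0 : 39 / 100 ≤ x) (h1 : x ≤ 2 / 5) (hr : rho x < 1) :
    GF PPc (ENNReal.ofReal x) ≤ ENNReal.ofReal (3000000 / (1 - rho x)) := by
  have hd : 0 < 1 - rho x := by linarith
  set X := ENNReal.ofReal x
  calc GF PPc X ≤ ∑' i : (Bool × Bool × Bool × Bool) × WW, (1 : ℝ≥0∞) * X ^ (i.2 : F2).norm := by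
        apply GF_cover (fun i => Dx i.1.1 i.1.2.1 i.1.2.2.1 (pw i.1.2.2.2 i.2))
        intro w hw
        obtain ⟨t, ε, δ, s, v, hv, e, hn⟩ := PPc_WW hw
        refine ⟨⟨⟨t, ε, δ, s⟩, ⟨v, hv⟩⟩, e.symm, ?_⟩
        simp [hn]
    _ = 16 * GF WW X := by
        rw [tsum_mul_prod (fun _ : (Bool × Bool × Bool × Bool) => (1 : ℝ≥0∞)) (fun i : WW => X ^ (i : F2).norm)]
        congr 1
        rw [tsum_fintype]; simp
    _ ≤ 16 * ENNReal.ofReal (170000 / (1 - rho x)) := by gcongr; exact GF_WW h0 h1 hr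
    _ ≤ _ := by
      have : (16 : ℝ≥0∞) = ENNReal.ofReal 16 := by simp
      rw [this, ← ENNReal.ofReal_mul (by norm_num)]
      apply ENNReal.ofReal_le_ofReal
      rw [mul_div_assoc']; gcongr; norm_num

end

section
open scoped ENNReal

abbrev Code := ℤ ⊕ (ℕ × ℕ)

def cu : Code → List Lt
  | .inl k => List.replicate k.natAbs (0, decide (0 ≤ k))
  | .inr (i, j) => List.replicate (i + 1) (0, true) ++ (1, false) :: List.replicate (j + 1) (0, true)

def cat : List Code → List Lt
  | [] => []
  | c :: l => cu c ++ (1, true) :: cat l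

def step (s : Fin 6) (c : Lt) : Fin 6 :=
  match s, c with
  | 0, (0, true) => 1
  | 0, (0, false) => 2
  | 0, (1, true) => 0
  | 1, (0, true) => 1
  | 1, (1, true) => 0
  | 1, (1, false) => 3
  | 2, (0, false) => 2
  | 2, (1, true) => 0
  | 3, (0, true) => 4
  | 4, (0, true) => 4
  | 4, (1, true) => 0
  | _, _ => 5

def run (s : Fin 6) (l : List Lt) : Fin 6 := l.foldl step s

lemma dfa_append (s l m) : run s (l ++ m) = run (run s l) m := by simp [run]
lemma dfa_cons (s c l) : run s (c :: l) = run (step s c) l := rfl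
lemma dfa_F (l) : run 5 l = 5 := by
  induction l with
  | nil => rfl
  | cons c l ih =>
    rw [dfa_cons]
    have : ∀ c : Lt, step 5 c = 5 := by decide
    rw [this, ih]

lemma dfa_rep (s : Fin 6) (c : Lt) (h : step s c = s) (n : ℕ) : run s (List.replicate n c) = s := by
  induction n with
  | zero => rfl
  | succ n ih => rw [List.replicate_succ, dfa_cons, h, ih]

lemma dfa_code (c : Code) : run 0 (cu c ++ [(1, true)]) = 0 := by
  rcases c with k | ⟨i, j⟩
  · simp only [cu]
    rw [dfa_append]
    generalize decide (0 ≤ k) = s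
    rcases h : k.natAbs with _ | n
    · simp [run]; decide
    · rw [List.replicate_succ, dfa_cons 0]
      rcases s with _ | _
      · rw [show step 0 ((0 : Fin 2), false) = 2 by decide, dfa_rep 2 _ (by decide)]; decide
      · rw [show step 0 ((0 : Fin 2), true) = 1 by decide, dfa_rep 1 _ (by decide)]; decide
  · simp only [cu]
    rw [dfa_append, dfa_append, List.replicate_succ, dfa_cons 0, show step 0 ((0 : Fin 2), true) = 1 by decide,
      dfa_rep 1 _ (by decide), dfa_cons 1, show step 1 ((1 : Fin 2), false) = 3 by decide, List.replicate_succ, dfa_cons 3,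
      show step 3 ((0 : Fin 2), true) = 4 by decide, dfa_rep 4 _ (by decide)]
    decide

lemma dfa_cat (l : List Code) : run 0 (cat l) = 0 := by
  induction l with
  | nil => rfl
  | cons c l ih =>
    have : cat (c :: l) = (cu c ++ [(1, true)]) ++ cat l := by simp [cat]
    rw [this, dfa_append, dfa_code, ih]

lemma cat_append (l m : List Code) : cat (l ++ m) = cat l ++ cat m := by
  induction l with
  | nil => rfl
  | cons c l ih => simp [cat, ih]

lemma dfa_inf {u M : List Lt} (h : u <:+: M) (hM : run 0 M = 0) : ∃ s, run s u ≠ 5 := by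
  obtain ⟨p, q, rfl⟩ := h
  refine ⟨run 0 p, fun h => ?_⟩
  rw [dfa_append, dfa_append, h, dfa_F] at hM
  exact absurd hM (by decide)

lemma dfa_red (M : List Lt) : ∀ s, run s M ≠ 5 → FreeGroup.IsReduced M := by
  induction M with
  | nil => intro s _; exact List.IsChain.nil
  | cons c M ih =>
    intro s h
    rcases M with _ | ⟨d, M⟩
    · exact List.IsChain.singleton _
    · refine List.IsChain.cons_cons ?_ (ih _ h)
      have key : ∀ (s : Fin 6) (c d : Lt), step (step s c) d ≠ 5 → c.1 = d.1 → c.2 = d.2 := by decide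
      apply key s c d
      intro h5
      rw [dfa_cons, dfa_cons, h5, dfa_F] at h
      exact h rfl

lemma bad3 (k : ℕ) (s : Fin 6) : run s ([lBi] ++ List.replicate k lA ++ [lBi]) = 5 := by
  rw [dfa_append, dfa_append]
  have h1 : ∀ s : Fin 6, run s [lBi] = 3 ∨ run s [lBi] = 5 := by decide
  have h2 : run 3 (List.replicate k lA) = 3 ∨ run 3 (List.replicate k lA) = 4 := by
    rcases k with _ | k
    · left; rfl
    · right
      rw [List.replicate_succ, dfa_cons, show step 3 lA = 4 by decide, dfa_rep 4 _ (by decide)]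
  rcases h1 s with h | h
  · rw [h]
    rcases h2 with h | h <;> rw [h] <;> decide
  · rw [h, dfa_F, dfa_F]

lemma cat_word (l : List Code) : (FreeGroup.mk (cat l) : F2).toWord = cat l := by
  have : FreeGroup.IsReduced (cat l) := dfa_red _ 0 (by rw [dfa_cat]; decide)
  rw [FreeGroup.toWord_mk]
  exact this.reduce_eq

lemma cat_Rinf (l : List Code) : (FreeGroup.mk (cat l) : F2) ∈ Rinf := by
  have h2 : run 0 (cat l ++ cat l) = 0 := by rw [← cat_append, dfa_cat]
  refine ⟨?_, ?_, ?_, ?_⟩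
  · rw [cyc_iff, CR_iff, cat_word]
    exact dfa_red _ 0 (by rw [h2]; decide)
  · rintro ⟨-, h⟩
    rw [cat_word] at h
    obtain ⟨s, hs⟩ := dfa_inf h h2
    revert s; decide
  · rintro ⟨-, h⟩
    rw [cat_word] at h
    obtain ⟨s, hs⟩ := dfa_inf h h2
    revert s; decide
  · rintro k ⟨-, h⟩
    rw [cat_word] at h
    obtain ⟨s, hs⟩ := dfa_inf h h2
    exact hs (bad3 k s)

lemma cu_nm (c : Code) : ((1 : Fin 2), true) ∉ cu c := by
  rcases c with k | ⟨i, j⟩ <;> simp [cu, List.mem_replicate]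

lemma cu_nm2 (k : ℤ) : ((1 : Fin 2), false) ∉ cu (.inl k) := by
  simp [cu, List.mem_replicate]

lemma split_inj {α : Type} {a : α} : ∀ {u v p q : List α}, a ∉ u → a ∉ v → u ++ a :: p = v ++ a :: q → u = v ∧ p = q
  | [], [], p, q, _, _, h => by simpa using h
  | [], b :: v, p, q, _, hv, h => by simp at h hv; exact absurd h.1 hv.1
  | b :: u, [], p, q, hu, _, h => by simp at h hu; exact absurd h.1.symm hu.1
  | b :: u, c :: v, p, q, hu, hv, h => by
    simp at h hu hv
    obtain ⟨h1, h2⟩ := split_inj hu.2 hv.2 h.2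
    exact ⟨by rw [h.1, h1], h2⟩

lemma cu_inj : Function.Injective cu := by
  rintro (k | ⟨i, j⟩) (k' | ⟨i', j'⟩) h
  · have h1 := congrArg List.length h
    simp [cu] at h1
    congr 1
    rcases hk : k.natAbs with _ | n
    · omega
    · simp only [cu] at h
      rw [← h1, hk, List.replicate_succ, List.replicate_succ] at h
      simp at h
      by_cases h0 : 0 ≤ k
      · have := h.1.1 h0; omega
      · have : ¬ 0 ≤ k' := fun h' => h0 (h.1.2 h'); omega
  · exfalso
    apply cu_nm2 k; rw [h]; simp [cu]
  · exfalso
    apply cu_nm2 k'; rw [← h]; simp [cu]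
  · simp only [cu] at h
    obtain ⟨h1, h2⟩ := split_inj (by simp [List.mem_replicate]) (by simp [List.mem_replicate]) h
    have a := congrArg List.length h1
    have b := congrArg List.length h2
    simp at a b
    rw [a, b]

lemma cat_inj : Function.Injective cat := by
  intro l
  induction l with
  | nil => intro m h; rcases m with _ | ⟨c, m⟩
           · rfl
           · simp [cat] at h
  | cons c l ih =>
    intro m h
    rcases m with _ | ⟨d, m⟩
    · simp [cat] at h
    · obtain ⟨h1, h2⟩ := split_inj (cu_nm c) (cu_nm d) h
      rw [cu_inj h1, ih h2]

lemma code_sum {x : ℝ} (h0 : 0 ≤ x) (h1 : x < 1) :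
    ∑' c : Code, (ENNReal.ofReal x) ^ ((cu c).length + 1) = ENNReal.ofReal (rho x) := by
  have hx : 0 < 1 - x := by linarith
  have e : ∀ p : ℕ × ℕ, (cu (.inr p)).length + 1 = (p.1 + 2) + (p.2 + 2) := by
    rintro ⟨i, j⟩; simp [cu]; omega
  have e1 : ∀ k : ℤ, (cu (.inl k)).length + 1 = k.natAbs + 1 := by intro k; simp [cu]
  rw [Summable.tsum_sum ENNReal.summable ENNReal.summable]
  simp only [e, e1]
  rw [top_sum h0 h1]
  simp only [pow_add _ (_ + 2) (_ + 2)]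
  rw [tsum_mul_prod (fun n : ℕ => ENNReal.ofReal x ^ (n + 2)) (fun n : ℕ => ENNReal.ofReal x ^ (n + 2)),
    geo_sum h0 h1, ← ENNReal.ofReal_mul (by positivity), ← ENNReal.ofReal_add (by positivity) (by positivity)]
  congr 1
  unfold rho; ring

lemma GF_Rinf {x : ℝ} (h0 : 0 ≤ x) (h1 : x < 1) (hr : rho x < 1) :
    ENNReal.ofReal (1 / (1 - rho x)) ≤ GF Rinf (ENNReal.ofReal x) := by
  have hd : 0 < 1 - rho x := by linarith
  have hx : 0 < 1 - x := by linarith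
  have hr0 : 0 ≤ rho x := by unfold rho; positivity
  set X := ENNReal.ofReal x
  set T := ∑' l : List Code, X ^ (cat l).length with hT
  have hTe : T = 1 + ENNReal.ofReal (rho x) * T := by
    conv_lhs => rw [hT, tsum_list]
    have : ∀ (c : Code) l, X ^ (cat (c :: l)).length = X ^ ((cu c).length + 1) * X ^ (cat l).length := by
      intro c l; rw [← pow_add]; congr 1; simp [cat]; omega
    simp only [this, ENNReal.tsum_mul_left, ENNReal.tsum_mul_right]
    rw [code_sum h0 h1]
    simp [cat, hT]
  have hle : T ≤ GF Rinf X := by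
    have hinj : Function.Injective (fun l : List Code => (⟨FreeGroup.mk (cat l), cat_Rinf l⟩ : Rinf)) := by
      intro l m h
      have := congrArg (fun w : Rinf => (w : F2).toWord) h
      simp only [cat_word] at this
      exact cat_inj this
    have := ENNReal.tsum_comp_le_tsum_of_injective hinj (fun w : Rinf => X ^ (w : F2).norm)
    refine le_trans (le_of_eq ?_) this
    refine tsum_congr fun l => ?_
    simp only [FreeGroup.norm, cat_word]
  refine le_trans ?_ hle
  by_cases htop : T = ⊤
  · rw [htop]; exact le_top
  rw [ENNReal.ofReal_le_iff_le_toReal htop]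
  have := congrArg ENNReal.toReal hTe
  rw [ENNReal.toReal_add (by simp) (ENNReal.mul_ne_top (by simp) htop), ENNReal.toReal_mul,
    ENNReal.toReal_ofReal hr0, ENNReal.toReal_one] at this
  rw [div_le_iff₀ hd]
  linarith

end

section
open scoped ENNReal

lemma fib_finite (S : Set F2) (n : ℕ) : Finite {w : F2 // w ∈ S ∧ FreeGroup.norm w = n} := by
  have : Function.Injective (fun w : {w : F2 // w ∈ S ∧ FreeGroup.norm w = n} =>
      (⟨w.1.toWord, w.2.2⟩ : List.Vector Lt n)) := by
    intro a b h
    have h' := congrArg Subtype.val h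
    exact Subtype.ext (FreeGroup.toWord_injective h')
  exact @Finite.of_injective _ (List.Vector Lt n) inferInstance _ this

lemma GF_growth (S : Set F2) (X : ℝ≥0∞) : GF S X = ∑' n : ℕ, (growth2 S n : ℝ≥0∞) * X ^ n := by
  unfold GF
  rw [← (Equiv.sigmaFiberEquiv (fun w : S => (w : F2).norm)).tsum_eq, ENNReal.tsum_sigma']
  refine tsum_congr fun n => ?_
  have h : ∀ b : {w : S // (w : F2).norm = n},
      X ^ (((Equiv.sigmaFiberEquiv (fun w : S => (w : F2).norm)) ⟨n, b⟩ : S) : F2).norm = X ^ n := by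
    rintro ⟨b, rfl⟩; rfl
  simp only [h]
  have e : {w : S // (w : F2).norm = n} ≃ {w : F2 // w ∈ S ∧ FreeGroup.norm w = n} :=
    Equiv.subtypeSubtypeEquivSubtypeInter (fun w => w ∈ S) (fun w : F2 => w.norm = n)
  have := fib_finite S n
  have f2 : Finite {w : S // (w : F2).norm = n} := Finite.of_equiv _ e.symm
  have := Fintype.ofFinite {w : S // (w : F2).norm = n}
  rw [tsum_fintype, Finset.sum_const, Finset.card_univ, nsmul_eq_mul, growth2, ← Nat.card_congr e,
    Nat.card_eq_fintype_card]

lemma exists_x (η : ℝ) (h0 : 0 ≤ η) (h1 : η ≤ 1 / 100) : ∃ x : ℝ, 39 / 100 ≤ x ∧ x ≤ 2 / 5 ∧ rho x = 1 - η := by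
  have hc : ContinuousOn rho (Set.Icc (39 / 100) (2 / 5)) := by
    unfold rho
    have : ∀ x ∈ Set.Icc (39 / 100 : ℝ) (2 / 5), 1 - x ≠ 0 := by
      rintro x ⟨-, h⟩; linarith
    fun_prop (disch := assumption)
  have := intermediate_value_Icc (by norm_num) hc
  obtain ⟨x, hx, e⟩ := this (show 1 - η ∈ Set.Icc (rho (39 / 100)) (rho (2 / 5)) by
    constructor
    · have : rho (39 / 100) ≤ 96 / 100 := by unfold rho; norm_num
      linarith
    · have : 1 ≤ rho (2 / 5) := by unfold rho; norm_num
      linarith)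
  exact ⟨x, hx.1, hx.2, e⟩

end

theorem Rinf_not_negligible_in_PPc :
    ¬ Filter.Tendsto
      (fun n : ℕ => ((growth2 Rinf n : ℝ) + 1) / ((growth2 PPc n : ℝ) + 1))
      Filter.atTop (nhds 0) := by
  intro hT
  have hev := hT.eventually (gt_mem_nhds (show (0 : ℝ) < 1 / 6000000 by norm_num))
  obtain ⟨N, hN⟩ := Filter.eventually_atTop.1 hev
  set K : ℝ := ∑ n ∈ Finset.range N, ((growth2 Rinf n : ℝ) + 1) with hK
  have hK0 : 0 ≤ K := Finset.sum_nonneg fun i _ => by positivity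
  set η : ℝ := 1 / (100 * (K + 1)) with hη
  have hη0 : 0 < η := by positivity
  have hη1 : η ≤ 1 / 100 := by
    rw [hη]; gcongr; linarith
  obtain ⟨x, hx1, hx2, hr⟩ := exists_x η hη0.le hη1
  have hx0 : 0 ≤ x := by linarith
  have hr1 : rho x < 1 := by linarith
  have lo := GF_Rinf hx0 (by linarith) hr1
  have up := GF_PPc hx1 hx2 hr1
  have hd : 1 - rho x = η := by linarith
  rw [hd] at lo up
  set X := ENNReal.ofReal x with hX
  have hX1 : X ≤ 1 := by rw [hX]; exact ENNReal.ofReal_le_one.2 (by linarith)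
  have pt : ∀ n : ℕ, (growth2 Rinf n : ENNReal) * X ^ n ≤
      (ENNReal.ofReal (1 / 6000000) * ((growth2 PPc n : ENNReal) * X ^ n) + ENNReal.ofReal (1 / 6000000) * X ^ n) +
      (if n < N then ENNReal.ofReal ((growth2 Rinf n : ℝ) + 1) else 0) := by
    intro n
    by_cases hn : n < N
    · rw [if_pos hn]
      refine le_trans ?_ le_add_self
      calc (growth2 Rinf n : ENNReal) * X ^ n ≤ (growth2 Rinf n : ENNReal) * 1 := by
            gcongr; exact pow_le_one' hX1 n
        _ = ENNReal.ofReal (growth2 Rinf n : ℝ) := by simp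
        _ ≤ _ := ENNReal.ofReal_le_ofReal (by linarith)
    · rw [if_neg hn, add_zero, ← mul_add]
      have h := hN n (by omega)
      rw [div_lt_iff₀ (by positivity)] at h
      calc (growth2 Rinf n : ENNReal) * X ^ n = ENNReal.ofReal (growth2 Rinf n : ℝ) * X ^ n := by simp
        _ ≤ ENNReal.ofReal (1 / 6000000 * ((growth2 PPc n : ℝ) + 1)) * X ^ n := by
            gcongr; linarith
        _ = _ := by
            rw [ENNReal.ofReal_mul (by norm_num), ENNReal.ofReal_add (by positivity) (by norm_num)]
            simp only [ENNReal.ofReal_natCast, ENNReal.ofReal_one]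
            ring
  have total := ENNReal.tsum_le_tsum pt
  rw [← GF_growth, ENNReal.tsum_add, ENNReal.tsum_add, ENNReal.tsum_mul_left, ENNReal.tsum_mul_left,
    ← GF_growth] at total
  have s1 : ∑' n : ℕ, X ^ n ≤ ENNReal.ofReal 2 := by
    have g := geo_sum hx0 (by linarith : x < 1) 0
    simp only [add_zero] at g
    rw [g]
    apply ENNReal.ofReal_le_ofReal
    rw [div_le_iff₀ (by linarith)]; linarith
  have s2 : ∑' n : ℕ, (if n < N then ENNReal.ofReal ((growth2 Rinf n : ℝ) + 1) else 0) = ENNReal.ofReal K := by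
    rw [tsum_eq_sum (s := Finset.range N) (by
      intro n hn; simp at hn; rw [if_neg (by omega)]), hK, ENNReal.ofReal_sum_of_nonneg (fun i _ => by positivity)]
    refine Finset.sum_congr rfl fun n hn => ?_
    rw [if_pos (Finset.mem_range.1 hn)]
  rw [s2] at total
  have fin : ENNReal.ofReal (1 / η) ≤ ENNReal.ofReal (1 / 6000000 * (3000000 / η) + 1 / 6000000 * 2 + K) := by
    calc _ ≤ _ := lo
      _ ≤ _ := total
      _ ≤ (ENNReal.ofReal (1 / 6000000) * ENNReal.ofReal (3000000 / η) + ENNReal.ofReal (1 / 6000000) * ENNReal.ofReal 2) + ENNReal.ofReal K := by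
        gcongr
      _ = _ := by
        rw [← ENNReal.ofReal_mul (by norm_num), ← ENNReal.ofReal_mul (by norm_num),
          ← ENNReal.ofReal_add (by positivity) (by positivity), ← ENNReal.ofReal_add (by positivity) hK0]
  rw [ENNReal.ofReal_le_ofReal_iff (by positivity)] at fin
  have e1 : 3000000 / η = 3000000 * (1 / η) := by ring
  have e2 : 1 / η = 100 * (K + 1) := by rw [hη]; simp
  rw [e1, e2] at fin
  linarith
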